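/- arXiv:2111.00092 — 8 statements merged into one kernel-verified Lean document; each statement's English description precedes it below -/
import Mathlib

section
/- Fix a real ε > 0 and a constant c ≥ 0. Let 𝒵 ⊆ ℝ^m be a nonempty finite set, x ∈ ℝ^m, and let q(·|x) and p be probability mass functions on 𝒵 with p(z) > 0 and |ln(q(z|x)/p(z))| ≤ ε for all z ∈ 𝒵. Let N be a positive integer with N ≥ 2^{(log₂(e) + 4c)·ε}, and let Z_1,…,Z_N be i.i.d. random elements of 𝒵 with law p. Set W_k := q(Z_k|x)/p(Z_k), π(k) := W_k/Σ_{k'=1}^N W_{k'}, and α := sqrt(2^{−c·ε} + 2^{1 − c²/log₂(e)}), and assume α < 1. Then with probability at least 1 − 2α over the candidates Z_1,…,Z_N, one has | Σ_{k=1}^N π(k)·‖Z_k − x‖² − E_{Z∼q(·|x)}[‖Z − x‖²] | ≤ (2α/(1−α))·sqrt( E_{Z∼q(·|x)}[‖Z − x‖⁴] ). -/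
open scoped Classical
open Real Finset

section

variable {E : Type*} {Z : Finset E} {p q : E → ℝ} {N : ℕ}

/-- Expectation of `F` over `N` i.i.d. draws from the mass function `p` on `Z`. -/
noncomputable def iidExpect (Z : Finset E) (p : E → ℝ) (N : ℕ) (F : (Fin N → E) → ℝ) : ℝ :=
  ∑ zs ∈ Fintype.piFinset (fun _ : Fin N => Z), (∏ k, p (zs k)) * F zs

lemma iidExpect_mono (hp0 : ∀ z ∈ Z, 0 ≤ p z) {F G : (Fin N → E) → ℝ}
    (h : ∀ zs, (∀ k, zs k ∈ Z) → F zs ≤ G zs) :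
    iidExpect Z p N F ≤ iidExpect Z p N G := by
  refine Finset.sum_le_sum fun zs hzs => ?_
  rw [Fintype.mem_piFinset] at hzs
  exact mul_le_mul_of_nonneg_left (h zs hzs) (Finset.prod_nonneg fun k _ => hp0 _ (hzs k))

lemma iidExpect_add (F G : (Fin N → E) → ℝ) :
    iidExpect Z p N (fun zs => F zs + G zs) = iidExpect Z p N F + iidExpect Z p N G := by
  simp [iidExpect, mul_add, Finset.sum_add_distrib]

lemma iidExpect_const_mul (r : ℝ) (F : (Fin N → E) → ℝ) :
    iidExpect Z p N (fun zs => r * F zs) = r * iidExpect Z p N F := by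
  simp only [iidExpect, Finset.mul_sum]
  exact Finset.sum_congr rfl fun _ _ => by ring

lemma iidExpect_sum {ι : Type*} (s : Finset ι) (F : ι → (Fin N → E) → ℝ) :
    iidExpect Z p N (fun zs => ∑ i ∈ s, F i zs) = ∑ i ∈ s, iidExpect Z p N (F i) := by
  simp only [iidExpect, Finset.mul_sum]
  exact Finset.sum_comm

lemma iidExpect_prod (h : Fin N → E → ℝ) :
    iidExpect Z p N (fun zs => ∏ k, h k (zs k)) = ∏ k, ∑ z ∈ Z, p z * h k z := by
  simp only [iidExpect, ← Finset.prod_mul_distrib]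
  exact (Finset.prod_univ_sum (fun _ => Z) (fun k z => p z * h k z)).symm

lemma iidExpect_const (hp1 : ∑ z ∈ Z, p z = 1) (r : ℝ) : iidExpect Z p N (fun _ => r) = r := by
  have h := iidExpect_prod (Z := Z) (p := p) (fun (_ : Fin N) _ => 1)
  have h' := iidExpect_const_mul (Z := Z) (p := p) (N := N) r fun _ => 1
  simp only [Finset.prod_const_one, mul_one, hp1] at h h'
  rw [h', h, mul_one]

lemma iidExpect_eval (hp1 : ∑ z ∈ Z, p z = 1) (g : E → ℝ) (k : Fin N) :
    iidExpect Z p N (fun zs => g (zs k)) = ∑ z ∈ Z, p z * g z := by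
  have h := iidExpect_prod (Z := Z) (p := p) (fun i z => if i = k then g z else 1)
  simp only [Finset.prod_ite_eq', Finset.mem_univ, if_true] at h
  rw [h, Finset.prod_eq_single k]
  · simp
  · intro i _ hi
    simp [hi, hp1]
  · simp

lemma iidExpect_eval_mul_eval (g : E → ℝ)
    (hg : ∑ z ∈ Z, p z * g z = 0) {k l : Fin N} (hkl : k ≠ l) :
    iidExpect Z p N (fun zs => g (zs k) * g (zs l)) = 0 := by
  have h := iidExpect_prod (Z := Z) (p := p)
    (fun i z => (if i = k then g z else 1) * (if i = l then g z else 1))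
  simp only [Finset.prod_mul_distrib, Finset.prod_ite_eq', Finset.mem_univ, if_true] at h
  rw [h]
  refine Finset.prod_eq_zero (Finset.mem_univ k) ?_
  simpa [hkl] using hg

lemma iidExpect_sum_sq (hp1 : ∑ z ∈ Z, p z = 1) (g : E → ℝ)
    (hg : ∑ z ∈ Z, p z * g z = 0) :
    iidExpect Z p N (fun zs => (∑ k, g (zs k)) ^ 2) = N * ∑ z ∈ Z, p z * g z ^ 2 := by
  simp only [sq, Finset.sum_mul_sum, iidExpect_sum]
  have h : ∀ k : Fin N, ∑ l, iidExpect Z p N (fun zs => g (zs k) * g (zs l))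
      = ∑ z ∈ Z, p z * (g z * g z) := by
    intro k
    rw [Finset.sum_eq_single k]
    · exact iidExpect_eval hp1 (fun z => g z * g z) k
    · exact fun l _ hl => iidExpect_eval_mul_eval g hg hl.symm
    · simp
  simp [h]

lemma iidExpect_abs_le_sqrt (hp0 : ∀ z ∈ Z, 0 ≤ p z) (hp1 : ∑ z ∈ Z, p z = 1)
    (F : (Fin N → E) → ℝ) :
    iidExpect Z p N (fun zs => |F zs|) ≤ √(iidExpect Z p N (fun zs => F zs ^ 2)) := by
  have hw : ∀ zs ∈ Fintype.piFinset (fun _ : Fin N => Z), 0 ≤ ∏ k, p (zs k) := fun zs hzs =>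
    Finset.prod_nonneg fun k _ => hp0 _ (Fintype.mem_piFinset.1 hzs k)
  have h1 := iidExpect_const (N := N) hp1 1
  simp only [iidExpect] at h1 ⊢
  refine Real.le_sqrt_of_sq_le ?_
  have := Finset.sum_sq_le_sum_mul_sum_of_sq_le_mul (Fintype.piFinset (fun _ : Fin N => Z))
    (r := fun zs => (∏ k, p (zs k)) * |F zs|) (f := fun zs => (∏ k, p (zs k)) * F zs ^ 2)
    (g := fun zs => (∏ k, p (zs k)) * 1)
    (fun zs hzs => mul_nonneg (hw zs hzs) (sq_nonneg _))
    (fun zs hzs => by simpa using hw zs hzs)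
    (fun zs _ => le_of_eq (by rw [mul_pow, sq_abs]; ring))
  rwa [h1, mul_one] at this

/-- Mean absolute deviation of an empirical mean. -/
lemma iidExpect_abs_mean_sub_le (hp0 : ∀ z ∈ Z, 0 ≤ p z) (hp1 : ∑ z ∈ Z, p z = 1)
    (hN : 0 < N) (g : E → ℝ) :
    iidExpect Z p N (fun zs => |(∑ k, g (zs k)) / N - ∑ z ∈ Z, p z * g z|)
      ≤ √((∑ z ∈ Z, p z * g z ^ 2) / N) := by
  have hN' : (N : ℝ) ≠ 0 := by positivity
  refine (iidExpect_abs_le_sqrt hp0 hp1 _).trans (Real.sqrt_le_sqrt ?_)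
  set μ := ∑ z ∈ Z, p z * g z with hμ
  have hc : ∑ z ∈ Z, p z * (g z - μ) = 0 := by
    simp [mul_sub, Finset.sum_sub_distrib, ← Finset.sum_mul, hp1, ← hμ]
  have hv : ∑ z ∈ Z, p z * (g z - μ) ^ 2 = (∑ z ∈ Z, p z * g z ^ 2) - μ ^ 2 := by
    have : ∀ z, p z * (g z - μ) ^ 2 = p z * g z ^ 2 - 2 * μ * (p z * g z) + μ ^ 2 * p z :=
      fun z => by ring
    simp only [this, Finset.sum_add_distrib, Finset.sum_sub_distrib, ← Finset.mul_sum, hp1, ← hμ]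
    ring
  have he : ∀ zs : Fin N → E, ((∑ k, g (zs k)) / N - μ) ^ 2
      = (1 / N ^ 2) * (∑ k, (g (zs k) - μ)) ^ 2 := by
    intro zs
    simp only [Finset.sum_sub_distrib, Finset.sum_const, Finset.card_univ, Fintype.card_fin,
      nsmul_eq_mul]
    field_simp
  simp only [he]
  rw [iidExpect_const_mul, iidExpect_sum_sq hp1 _ hc, hv]
  have : 1 / (N : ℝ) ^ 2 * (N * ((∑ z ∈ Z, p z * g z ^ 2) - μ ^ 2))
      = ((∑ z ∈ Z, p z * g z ^ 2) - μ ^ 2) / N := by field_simp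
  rw [this]
  gcongr
  nlinarith [sq_nonneg μ]

/-- Markov's inequality for the deviation bound `s ^ 2 * M`, allowing `M = 0`. -/
lemma iidExpect_indicator_le (hp0 : ∀ z ∈ Z, 0 < p z) {F : (Fin N → E) → ℝ} {s M : ℝ}
    (hs : 0 < s) (hM : 0 ≤ M) (hF : iidExpect Z p N (fun zs => |F zs|) ≤ s ^ 2 * M) :
    iidExpect Z p N (fun zs => if s * M < |F zs| then 1 else 0) ≤ s := by
  rcases hM.eq_or_lt with rfl | hM
  · have hw : ∀ zs ∈ Fintype.piFinset (fun _ : Fin N => Z), 0 < ∏ k, p (zs k) := fun zs hzs =>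
      Finset.prod_pos fun k _ => hp0 _ (Fintype.mem_piFinset.1 hzs k)
    have hnn : ∀ zs ∈ Fintype.piFinset (fun _ : Fin N => Z), 0 ≤ (∏ k, p (zs k)) * |F zs| :=
      fun zs hzs => mul_nonneg (hw zs hzs).le (abs_nonneg _)
    have h0 := (Finset.sum_eq_zero_iff_of_nonneg hnn).1
      (le_antisymm (by simpa [iidExpect] using hF) (Finset.sum_nonneg hnn))
    refine le_trans (Finset.sum_nonpos fun zs hzs => ?_) hs.le
    have : |F zs| = 0 := (mul_eq_zero.1 (h0 zs hzs)).resolve_left (hw zs hzs).ne'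
    simp [this]
  · have h : iidExpect Z p N (fun zs => s * M * (if s * M < |F zs| then 1 else 0))
        ≤ iidExpect Z p N (fun zs => |F zs|) := by
      refine iidExpect_mono (fun z hz => (hp0 z hz).le) fun zs _ => ?_
      split_ifs with h
      · simpa using h.le
      · simp
    rw [iidExpect_const_mul] at h
    have h' := h.trans hF
    refine le_of_mul_le_mul_left (a := s * M) ?_ (by positivity)
    linarith [h']

lemma sum_mul_abs_le_sqrt_mul_sqrt {S : Finset E} (hSZ : S ⊆ Z) (hq0 : ∀ z ∈ Z, 0 ≤ q z)
    (f : E → ℝ) :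
    ∑ z ∈ S, q z * |f z| ≤ √(∑ z ∈ Z, q z * f z ^ 2) * √(∑ z ∈ S, q z) := by
  have hS : ∀ z ∈ S, 0 ≤ q z := fun z hz => hq0 z (hSZ hz)
  have hZ : ∀ z ∈ Z, 0 ≤ q z * f z ^ 2 := fun z hz => mul_nonneg (hq0 z hz) (sq_nonneg _)
  rw [← Real.sqrt_mul (Finset.sum_nonneg hZ)]
  refine Real.le_sqrt_of_sq_le ?_
  refine (Finset.sum_sq_le_sum_mul_sum_of_sq_le_mul S (f := fun z => q z * f z ^ 2) (g := q)
    (fun z hz => hZ z (hSZ hz)) hS (fun z _ => le_of_eq (by rw [mul_pow, sq_abs]; ring))).trans ?_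
  exact mul_le_mul_of_nonneg_right
    (Finset.sum_le_sum_of_subset_of_nonneg hSZ fun z hz _ => hZ z hz) (Finset.sum_nonneg hS)

/-- The `L¹` error of importance sampling, with the likelihood ratio truncated at level `a`. -/
lemma iidExpect_abs_importance_sub_le (hq0 : ∀ z ∈ Z, 0 ≤ q z) (hp0 : ∀ z ∈ Z, 0 < p z)
    (hp1 : ∑ z ∈ Z, p z = 1) (hN : 0 < N) (f : E → ℝ) {a : ℝ} (ha : 0 ≤ a) :
    iidExpect Z p N (fun zs => |(∑ k, q (zs k) / p (zs k) * f (zs k)) / N - ∑ z ∈ Z, q z * f z|)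
      ≤ √(∑ z ∈ Z, q z * f z ^ 2)
        * (√(a / N) + 2 * √(∑ z ∈ Z with a < q z / p z, q z)) := by
  have hNpos : (0 : ℝ) < N := by positivity
  have hp0' : ∀ z ∈ Z, 0 ≤ p z := fun z hz => (hp0 z hz).le
  set g : E → ℝ := fun z => if a < q z / p z then 0 else q z / p z * f z with hg
  set b : E → ℝ := fun z => if a < q z / p z then q z / p z * |f z| else 0 with hb
  set S := {z ∈ Z | a < q z / p z} with hS
  have hpb : ∑ z ∈ Z, p z * b z = ∑ z ∈ S, q z * |f z| := by
    rw [hS, Finset.sum_filter]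
    refine Finset.sum_congr rfl fun z hz => ?_
    have := (hp0 z hz).ne'
    simp only [hb]
    split_ifs
    · field_simp
    · simp
  have habs : ∀ z ∈ Z, |q z / p z * f z - g z| ≤ b z := by
    intro z hz
    have := div_nonneg (hq0 z hz) (hp0' z hz)
    simp only [hg, hb]
    split_ifs
    · rw [sub_zero, abs_mul, abs_of_nonneg this]
    · simp
  have hbias : |(∑ z ∈ Z, p z * g z) - ∑ z ∈ Z, q z * f z| ≤ ∑ z ∈ S, q z * |f z| := by
    rw [← hpb, ← Finset.sum_sub_distrib]
    refine (Finset.abs_sum_le_sum_abs _ _).trans (Finset.sum_le_sum fun z hz => ?_)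
    have hz' := (hp0 z hz).ne'
    have : p z * g z - q z * f z = -(p z * (q z / p z * f z - g z)) := by field_simp; ring
    rw [this, abs_neg, abs_mul, abs_of_nonneg (hp0' z hz)]
    exact mul_le_mul_of_nonneg_left (habs z hz) (hp0' z hz)
  have hvar : ∑ z ∈ Z, p z * g z ^ 2 ≤ a * ∑ z ∈ Z, q z * f z ^ 2 := by
    rw [Finset.mul_sum]
    refine Finset.sum_le_sum fun z hz => ?_
    have hz' := (hp0 z hz).ne'
    have hqf : 0 ≤ q z * f z ^ 2 := mul_nonneg (hq0 z hz) (sq_nonneg _)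
    simp only [hg]
    split_ifs with h
    · simpa using mul_nonneg ha hqf
    · have : p z * (q z / p z * f z) ^ 2 = q z / p z * (q z * f z ^ 2) := by field_simp
      rw [this]
      exact mul_le_mul_of_nonneg_right (not_lt.1 h) hqf
  have hmean : iidExpect Z p N (fun zs => (1 / N : ℝ) * ∑ k, b (zs k)) = ∑ z ∈ S, q z * |f z| := by
    rw [iidExpect_const_mul, iidExpect_sum]
    simp only [iidExpect_eval hp1, hpb, Finset.sum_const, Finset.card_univ, Fintype.card_fin,
      nsmul_eq_mul]
    field_simp
  calc _ ≤ iidExpect Z p N (fun zs => (1 / N : ℝ) * ∑ k, b (zs k)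
          + (|(∑ k, g (zs k)) / N - ∑ z ∈ Z, p z * g z| + ∑ z ∈ S, q z * |f z|)) := by
        refine iidExpect_mono hp0' fun zs hzs => ?_
        have h1 : |(∑ k, q (zs k) / p (zs k) * f (zs k)) / N - (∑ k, g (zs k)) / N|
            ≤ (1 / N : ℝ) * ∑ k, b (zs k) := by
          rw [← sub_div, ← Finset.sum_sub_distrib, abs_div, abs_of_pos hNpos, div_eq_inv_mul,
            one_div]
          gcongr
          exact (Finset.abs_sum_le_sum_abs _ _).trans
            (Finset.sum_le_sum fun k _ => habs _ (hzs k))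
        refine (abs_sub_le _ ((∑ k, g (zs k)) / N) _).trans (add_le_add h1 ?_)
        exact (abs_sub_le _ (∑ z ∈ Z, p z * g z) _).trans (add_le_add le_rfl hbias)
    _ = iidExpect Z p N (fun zs => |(∑ k, g (zs k)) / N - ∑ z ∈ Z, p z * g z|)
          + 2 * ∑ z ∈ S, q z * |f z| := by
        rw [iidExpect_add, iidExpect_add, hmean, iidExpect_const hp1]
        ring
    _ ≤ √(a / N * ∑ z ∈ Z, q z * f z ^ 2)
          + 2 * (√(∑ z ∈ Z, q z * f z ^ 2) * √(∑ z ∈ S, q z)) := by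
        refine add_le_add ((iidExpect_abs_mean_sub_le hp0' hp1 hN g).trans
          (Real.sqrt_le_sqrt ?_)) ?_
        · rw [div_mul_eq_mul_div]
          gcongr
        · exact mul_le_mul_of_nonneg_left
            (sum_mul_abs_le_sqrt_mul_sqrt (Finset.filter_subset _ _) hq0 f) two_pos.le
    _ = _ := by
        rw [Real.sqrt_mul (by positivity)]
        ring

open MeasureTheory ProbabilityTheory in
/-- Hoeffding's tail bound for a finite mass function. -/
lemma sum_filter_le_exp_of_abs_le (hq0 : ∀ z ∈ Z, 0 ≤ q z) (hq1 : ∑ z ∈ Z, q z = 1)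
    {X : E → ℝ} {ε t : ℝ} (hX : ∀ z ∈ Z, |X z| ≤ ε) (ht : 0 ≤ t) :
    ∑ z ∈ Z with (∑ y ∈ Z, q y * X y) + t ≤ X z, q z ≤ Real.exp (-t ^ 2 / (2 * ε ^ 2)) := by
  set μ : Measure ℝ := ∑ z ∈ Z, ENNReal.ofReal (q z) • Measure.dirac (X z) with hμ
  have hprob : IsProbabilityMeasure μ := by
    constructor
    simp [hμ, ← ENNReal.ofReal_sum_of_nonneg hq0, hq1]
  have hmem : ∀ᵐ y ∂μ, id y ∈ Set.Icc (-ε) ε := by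
    rw [ae_iff, hμ, Measure.finsetSum_apply]
    refine Finset.sum_eq_zero fun z hz => ?_
    have := abs_le.1 (hX z hz)
    simp [this.1, this.2]
  have hint : ∫ y, id y ∂μ = ∑ z ∈ Z, q z * X z := by
    rw [hμ, integral_finsetSum_measure]
    · refine Finset.sum_congr rfl fun z hz => ?_
      simp [integral_smul_measure, ENNReal.toReal_ofReal (hq0 z hz)]
    · intro z _
      exact (integrable_dirac (by simp)).smul_measure ENNReal.ofReal_ne_top
  have hsub := (hasSubgaussianMGF_of_mem_Icc aemeasurable_id hmem).measure_ge_le ht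
  rw [hint] at hsub
  have hset : MeasurableSet {y : ℝ | t ≤ id y - ∑ z ∈ Z, q z * X z} :=
    measurableSet_le measurable_const (measurable_id.sub_const _)
  have hreal : μ.real {y : ℝ | t ≤ id y - ∑ z ∈ Z, q z * X z}
      = ∑ z ∈ Z with (∑ y ∈ Z, q y * X y) + t ≤ X z, q z := by
    rw [Finset.sum_filter, Measure.real, hμ, Measure.finsetSum_apply, ENNReal.toReal_sum]
    · refine Finset.sum_congr rfl fun z hz => ?_
      rw [Measure.smul_apply, Measure.dirac_apply' _ hset]
      simp only [id_eq, Set.indicator_apply, Set.mem_ofPred_eq, Pi.one_apply, smul_eq_mul, mul_ite,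
        mul_one, mul_zero, le_sub_iff_add_le, add_comm t]
      split_ifs
      · exact ENNReal.toReal_ofReal (hq0 z hz)
      · rfl
    · intro z _
      rw [Measure.smul_apply, Measure.dirac_apply' _ hset]
      simp only [Set.indicator_apply]
      split_ifs <;> simp
  rw [hreal] at hsub
  refine hsub.trans_eq ?_
  congr 2
  rw [NNReal.coe_pow, NNReal.coe_div, coe_nnnorm, div_pow, Real.norm_eq_abs, sq_abs]
  push_cast
  ring

/-- On the event that both importance-sampling estimates are accurate, so is their quotient. -/
lemma abs_div_sub_le {A B I M s : ℝ} (hs : s < 1) (hI : |I| ≤ M)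
    (hA : |A - I| ≤ s * M) (hB : |B - 1| ≤ s) :
    |A / B - I| ≤ 2 * s / (1 - s) * M := by
  have hs0 : 0 ≤ s := (abs_nonneg _).trans hB
  have hM : 0 ≤ M := (abs_nonneg _).trans hI
  have hB1 : 1 - s ≤ B := by linarith [(abs_le.1 hB).1]
  have hBpos : 0 < B := by linarith
  have h1 : A / B - I = ((A - I) - I * (B - 1)) / B := by field_simp; ring
  have h2 : |(A - I) - I * (B - 1)| ≤ 2 * s * M := by
    refine (abs_sub _ _).trans ?_
    rw [abs_mul]
    have := mul_le_mul hI hB (abs_nonneg _) hM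
    linarith
  rw [h1, abs_div, abs_of_pos hBpos, div_mul_eq_mul_div]
  have : 0 < 1 - s := by linarith
  gcongr

/-- Self-normalized importance sampling concentrates as soon as plain importance sampling does. -/
lemma one_sub_two_mul_le_iidExpect_indicator (hq0 : ∀ z ∈ Z, 0 ≤ q z) (hq1 : ∑ z ∈ Z, q z = 1)
    (hp0 : ∀ z ∈ Z, 0 < p z) (hp1 : ∑ z ∈ Z, p z = 1) (hN : 0 < N) (f : E → ℝ) {a s : ℝ}
    (ha : 0 ≤ a) (hs0 : 0 < s) (hs1 : s < 1)
    (has : √(a / N) + 2 * √(∑ z ∈ Z with a < q z / p z, q z) ≤ s ^ 2) :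
    1 - 2 * s ≤ iidExpect Z p N (fun zs =>
      if |(∑ k, ((q (zs k) / p (zs k)) / ∑ k', q (zs k') / p (zs k')) * f (zs k))
          - ∑ z ∈ Z, q z * f z| ≤ 2 * s / (1 - s) * √(∑ z ∈ Z, q z * f z ^ 2)
        then 1 else 0) := by
  have hN' : (N : ℝ) ≠ 0 := by positivity
  set M := √(∑ z ∈ Z, q z * f z ^ 2) with hM
  have hf := iidExpect_indicator_le hp0 hs0 (Real.sqrt_nonneg _)
    ((iidExpect_abs_importance_sub_le hq0 hp0 hp1 hN f ha).trans
      ((mul_le_mul_of_nonneg_left has (Real.sqrt_nonneg _)).trans_eq (mul_comm _ _)))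
  have h1 := iidExpect_indicator_le hp0 hs0 (Real.sqrt_nonneg _)
    ((iidExpect_abs_importance_sub_le hq0 hp0 hp1 hN (fun _ => 1) ha).trans
      ((mul_le_mul_of_nonneg_left has (Real.sqrt_nonneg _)).trans_eq (mul_comm _ _)))
  simp only [← hM] at hf
  simp only [mul_one, one_pow, hq1, Real.sqrt_one] at h1
  have hI : |∑ z ∈ Z, q z * f z| ≤ M := by
    have h := sum_mul_abs_le_sqrt_mul_sqrt (Finset.Subset.refl Z) hq0 f
    rw [hq1, Real.sqrt_one, mul_one] at h
    refine ((Finset.abs_sum_le_sum_abs _ _).trans_eq ?_).trans h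
    exact Finset.sum_congr rfl fun z hz => by rw [abs_mul, abs_of_nonneg (hq0 z hz)]
  have hunion := iidExpect_mono (Z := Z) (p := p) (N := N)
    (fun z hz => (hp0 z hz).le) (F := fun _ => (1 : ℝ)) (G := fun zs =>
      (if |(∑ k, ((q (zs k) / p (zs k)) / ∑ k', q (zs k') / p (zs k')) * f (zs k))
          - ∑ z ∈ Z, q z * f z| ≤ 2 * s / (1 - s) * M then 1 else 0)
      + ((if s * M < |(∑ k, q (zs k) / p (zs k) * f (zs k)) / N - ∑ z ∈ Z, q z * f z|
          then 1 else 0)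
        + (if s < |(∑ k, q (zs k) / p (zs k)) / N - 1| then 1 else 0)))
    (fun zs _ => by
      have hquot : ∑ k, ((q (zs k) / p (zs k)) / ∑ k', q (zs k') / p (zs k')) * f (zs k)
          = ((∑ k, q (zs k) / p (zs k) * f (zs k)) / N)
            / ((∑ k, q (zs k) / p (zs k)) / N) := by
        rw [div_div_div_cancel_right₀ hN', Finset.sum_div]
        exact Finset.sum_congr rfl fun k _ => by ring
      by_cases hA : s * M < |(∑ k, q (zs k) / p (zs k) * f (zs k)) / N - ∑ z ∈ Z, q z * f z|
      · rw [if_pos hA]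
        split_ifs <;> norm_num
      by_cases hB : s < |(∑ k, q (zs k) / p (zs k)) / N - 1|
      · rw [if_pos hB]
        split_ifs <;> norm_num
      rw [hquot, if_pos (abs_div_sub_le hs1 hI (not_lt.1 hA) (not_lt.1 hB))]
      simp [hA, hB])
  rw [iidExpect_const hp1, iidExpect_add, iidExpect_add] at hunion
  linarith

end

/-- **Theorem 1 (Utility of MRC).**  With probability at least `1 - 2α` over `N` i.i.d.
candidates drawn from the reference distribution `p`, the self-normalized importance-sampling
(Minimal Random Coding) estimate of the expected squared error is within
`(2α/(1-α))·sqrt(E_q ‖Z - x‖⁴)` of the true expected squared error under `q(·|x)`. -/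
theorem mrc_utility
    (m : ℕ) (ε c : ℝ) (hε : 0 < ε) (hc : 0 ≤ c)
    (Z : Finset (EuclideanSpace ℝ (Fin m))) (hZ : Z.Nonempty)
    (x : EuclideanSpace ℝ (Fin m))
    (q p : EuclideanSpace ℝ (Fin m) → ℝ)
    (hq0 : ∀ z ∈ Z, 0 ≤ q z) (hq1 : ∑ z ∈ Z, q z = 1)
    (hp0 : ∀ z ∈ Z, 0 < p z) (hp1 : ∑ z ∈ Z, p z = 1)
    (hratio : ∀ z ∈ Z, |Real.log (q z / p z)| ≤ ε)
    (N : ℕ) (hN0 : 0 < N)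
    (hN : (N : ℝ) ≥ (2 : ℝ) ^ ((Real.logb 2 (Real.exp 1) + 4 * c) * ε))
    (α : ℝ)
    (hα : α = Real.sqrt ((2 : ℝ) ^ (-(c * ε)) + (2 : ℝ) ^ (1 - c ^ 2 / Real.logb 2 (Real.exp 1))))
    (hα1 : α < 1) :
    1 - 2 * α ≤
      ∑ zs ∈ Fintype.piFinset (fun _ : Fin N => Z),
        (if |(∑ k : Fin N,
                ((q (zs k) / p (zs k)) / ∑ k' : Fin N, q (zs k') / p (zs k')) * ‖zs k - x‖ ^ 2)
              - ∑ z ∈ Z, q z * ‖z - x‖ ^ 2|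
            ≤ (2 * α / (1 - α)) * Real.sqrt (∑ z ∈ Z, q z * ‖z - x‖ ^ 4)
         then ∏ k : Fin N, p (zs k) else 0) := by
  set L := ∑ z ∈ Z, q z * Real.log (q z / p z) with hL
  set r := c * Real.log 2 with hr
  have hlog2 : 0 < Real.log 2 := Real.log_pos one_lt_two
  have hr0 : 0 ≤ r := mul_nonneg hc hlog2.le
  have hLε : L ≤ ε := by
    calc L ≤ ∑ z ∈ Z, q z * ε := Finset.sum_le_sum fun z hz =>
          mul_le_mul_of_nonneg_left ((le_abs_self _).trans (hratio z hz)) (hq0 z hz)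
      _ = ε := by rw [← Finset.sum_mul, hq1, one_mul]
  have hα2 : α ^ 2 = Real.exp (-(r * ε)) + 2 * Real.exp (-r ^ 2) := by
    rw [hα, Real.sq_sqrt (by positivity), Real.rpow_sub two_pos, Real.rpow_one,
      Real.rpow_def_of_pos two_pos, Real.rpow_def_of_pos two_pos, Real.logb, Real.log_exp,
      div_eq_mul_inv 2, ← Real.exp_neg, hr]
    congr 3
    · ring
    · field_simp
  have hN' : Real.exp (ε + 4 * (r * ε)) ≤ N := by
    refine le_of_eq_of_le ?_ hN
    rw [Real.rpow_def_of_pos two_pos, Real.logb, Real.log_exp, hr]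
    congr 1
    field_simp
  have hα0 : 0 < α := by
    rw [hα]
    positivity
  have hvar : √(Real.exp (L + 2 * (r * ε)) / N) ≤ Real.exp (-(r * ε)) := by
    refine Real.sqrt_le_iff.2 ⟨(Real.exp_pos _).le, ?_⟩
    rw [div_le_iff₀ (by positivity), ← Real.exp_nat_mul]
    refine le_trans ?_ (mul_le_mul_of_nonneg_left hN' (Real.exp_pos _).le)
    rw [← Real.exp_add, Real.exp_le_exp]
    push_cast
    linarith
  have htail : √(∑ z ∈ Z with Real.exp (L + 2 * (r * ε)) < q z / p z, q z) ≤ Real.exp (-r ^ 2) := by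
    refine Real.sqrt_le_iff.2 ⟨(Real.exp_pos _).le, ?_⟩
    refine le_trans (Finset.sum_le_sum_of_subset_of_nonneg (fun z hz => ?_) fun z hz _ =>
      hq0 z (Finset.mem_filter.1 hz).1) ((sum_filter_le_exp_of_abs_le hq0 hq1 hratio
        (t := 2 * (r * ε)) (by positivity)).trans_eq ?_)
    · rw [Finset.mem_filter] at hz ⊢
      exact ⟨hz.1, (Real.le_log_iff_exp_le ((Real.exp_pos _).trans hz.2)).2 hz.2.le⟩
    · rw [← Real.exp_nat_mul]
      congr 1
      push_cast
      field_simp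
  have key := one_sub_two_mul_le_iidExpect_indicator hq0 hq1 hp0 hp1 hN0 (fun z => ‖z - x‖ ^ 2)
    (Real.exp_pos (L + 2 * (r * ε))).le hα0 hα1 (by rw [hα2]; linarith)
  simpa only [iidExpect, mul_ite, mul_one, mul_zero, ← pow_mul] using key
end

section
/- Let ε ≥ 0 and let the family q be ε-LDP. Then for every x, x' ∈ 𝒳, every N ≥ 1, all candidates z_1,…,z_N ∈ 𝒵 such that Σ_{k'=1}^N q(z_{k'}|x')/p(z_{k'}) > 0, and every k ∈ {1,…,N}: π^mrc_x(k) ≤ e^{2ε}·π^mrc_{x'}(k). -/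
open scoped Classical
open Real Finset

/-- If two nonnegative weight vectors agree up to a factor `C` in each direction, then their
normalizations agree up to a factor `C ^ 2`. -/
lemma div_sum_le_sq_mul_div_sum {ι : Type*} [Fintype ι] {w w' : ι → ℝ} {C : ℝ} (hC : 0 < C)
    (hw' : ∀ i, 0 ≤ w' i) (h : ∀ i, w i ≤ C * w' i) (h' : ∀ i, w' i ≤ C * w i)
    (hpos : 0 < ∑ i, w' i) (k : ι) :
    w k / ∑ i, w i ≤ C ^ 2 * (w' k / ∑ i, w' i) := by
  have hsum : ∑ i, w' i ≤ C * ∑ i, w i := by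
    rw [mul_sum]
    exact sum_le_sum fun i _ => h' i
  have hpos' : 0 < ∑ i, w i := pos_of_mul_pos_right (hpos.trans_le hsum) hC.le
  rw [← mul_div_assoc, div_le_div_iff₀ hpos' hpos]
  calc w k * ∑ i, w' i ≤ (C * w' k) * (C * ∑ i, w i) :=
        mul_le_mul (h k) hsum hpos.le (mul_nonneg hC.le (hw' k))
    _ = C ^ 2 * w' k * ∑ i, w i := by ring

/-- **Theorem 2 (Pure DP guarantee of MRC).**  If the family `q` is `ε`-LDP, then the MRC
index distribution `π^mrc_x(k) = (q(z_k|x)/p(z_k)) / Σ_{k'} (q(z_{k'}|x)/p(z_{k'}))` is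
`2ε`-LDP: `π^mrc_x(k) ≤ e^{2ε}·π^mrc_{x'}(k)`. -/
theorem mrc_pure_privacy
    {𝒳 τ : Type*} (ε : ℝ) (hε : 0 ≤ ε)
    (Z : Finset τ) (hZ : Z.Nonempty)
    (q : 𝒳 → τ → ℝ) (p : τ → ℝ)
    (hq0 : ∀ x, ∀ z ∈ Z, 0 ≤ q x z) (hq1 : ∀ x, ∑ z ∈ Z, q x z = 1)
    (hp : ∀ z ∈ Z, 0 < p z)
    (hLDP : ∀ x x', ∀ z ∈ Z, q x z ≤ Real.exp ε * q x' z)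
    (x x' : 𝒳) (N : ℕ) (hN : 1 ≤ N)
    (zs : Fin N → τ) (hzs : ∀ k, zs k ∈ Z)
    (hpos : 0 < ∑ k' : Fin N, q x' (zs k') / p (zs k'))
    (k : Fin N) :
    (q x (zs k) / p (zs k)) / (∑ k' : Fin N, q x (zs k') / p (zs k'))
      ≤ Real.exp (2 * ε) *
        ((q x' (zs k) / p (zs k)) / (∑ k' : Fin N, q x' (zs k') / p (zs k'))) := by
  have hratio : ∀ y y' i, q y (zs i) / p (zs i) ≤ Real.exp ε * (q y' (zs i) / p (zs i)) := by
    intro y y' i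
    rw [← mul_div_assoc]
    exact div_le_div_of_nonneg_right (hLDP y y' _ (hzs i)) (hp _ (hzs i)).le
  have hexp : Real.exp (2 * ε) = Real.exp ε ^ 2 := by
    rw [two_mul, Real.exp_add, sq]
  rw [hexp]
  exact div_sum_le_sq_mul_div_sum (w := fun i => q x (zs i) / p (zs i))
    (w' := fun i => q x' (zs i) / p (zs i)) (Real.exp_pos ε)
    (fun i => div_nonneg (hq0 x' _ (hzs i)) (hp _ (hzs i)).le) (hratio x x') (hratio x' x) hpos k
end

section
/- Let ε ≥ 0 and let the family q be ε-LDP with |ln(q(z|x)/p(z))| ≤ ε for all x ∈ 𝒳 and z ∈ 𝒵. Let c0 ≥ 0, δ ∈ (0,1], and let N be a positive integer with N ≥ e^{2ε+2c0}. Set a0 := e^{−c0}·sqrt((1/2)·ln(2/δ)), assume a0 < 1, and set ε0 := ln((1+a0)/(1−a0)). Draw Z_1,…,Z_N i.i.d. with law p and, given the candidates, draw K from π^mrc_x. Then for all x, x' ∈ 𝒳 and every set A of pairs ((z_1,…,z_N), k): P_x[((Z_1,…,Z_N), K) ∈ A] ≤ e^{ε+ε0}·P_{x'}[((Z_1,…,Z_N),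 K) ∈ A] + δ; that is, the MRC mechanism is (ε+ε0, δ)-locally differentially private. -/
open scoped Classical
open Real Finset

/-- **Hoeffding's lemma** for a weighted finite sum. -/
lemma sum_mul_exp_le_of_mem_Icc {τ : Type*} {Z : Finset τ} {p f : τ → ℝ} {a b : ℝ}
    (hp : ∀ z ∈ Z, 0 ≤ p z) (hp1 : ∑ z ∈ Z, p z = 1) (hf : ∀ z ∈ Z, f z ∈ Set.Icc a b)
    (hmean : ∑ z ∈ Z, p z * f z = 0) (t : ℝ) :
    ∑ z ∈ Z, p z * Real.exp (t * f z) ≤ Real.exp (((b - a) / 2) ^ 2 * t ^ 2 / 2) := by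
  let _ : MeasurableSpace τ := ⊤
  let μ : MeasureTheory.Measure τ :=
    ∑ z ∈ Z, ENNReal.ofReal (p z) • MeasureTheory.Measure.dirac z
  have hint : ∀ g : τ → ℝ, ∫ z, g z ∂μ = ∑ z ∈ Z, p z * g z := by
    intro g
    rw [MeasureTheory.integral_finsetSum_measure]
    · refine Finset.sum_congr rfl fun z hz => ?_
      rw [MeasureTheory.integral_smul_measure, MeasureTheory.integral_dirac,
        ENNReal.toReal_ofReal (hp z hz), smul_eq_mul]
    · intro z _
      exact (MeasureTheory.integrable_dirac (by simp)).smul_measure ENNReal.ofReal_ne_top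
  have : MeasureTheory.IsProbabilityMeasure μ := by
    constructor
    simp only [μ, MeasureTheory.Measure.coe_finsetSum, Finset.sum_apply,
      MeasureTheory.Measure.smul_apply, MeasureTheory.measure_univ, smul_eq_mul, mul_one]
    rw [← ENNReal.ofReal_sum_of_nonneg hp, hp1, ENNReal.ofReal_one]
  have hae : ∀ᵐ z ∂μ, f z ∈ Set.Icc a b := by
    rw [MeasureTheory.ae_iff]
    simp only [μ, MeasureTheory.Measure.coe_finsetSum, Finset.sum_apply,
      MeasureTheory.Measure.smul_apply, smul_eq_mul]
    refine Finset.sum_eq_zero fun z hz => ?_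
    rw [MeasureTheory.Measure.dirac_apply' _ MeasurableSpace.measurableSet_top, Set.indicator_of_notMem, mul_zero]
    simpa using hf z hz
  have h := (ProbabilityTheory.hasSubgaussianMGF_of_mem_Icc_of_integral_eq_zero
    (measurable_from_top (f := f)).aemeasurable hae ((hint f).trans hmean)).mgf_le t
  rw [ProbabilityTheory.mgf, hint] at h
  simpa [div_pow] using h

/-- **Hoeffding's inequality** for i.i.d. draws from a probability mass function on a finite set. -/
lemma sum_piFinset_tail_le {τ : Type*} {Z : Finset τ} {p f : τ → ℝ} {a b r : ℝ} (N : ℕ)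
    (hp : ∀ z ∈ Z, 0 ≤ p z) (hp1 : ∑ z ∈ Z, p z = 1) (hf : ∀ z ∈ Z, f z ∈ Set.Icc a b)
    (hmean : ∑ z ∈ Z, p z * f z = 0) (hab : a < b) (hr : 0 ≤ r) :
    ∑ zs ∈ Fintype.piFinset (fun _ : Fin N => Z),
        (if N * r ≤ ∑ j, f (zs j) then ∏ j, p (zs j) else 0)
      ≤ Real.exp (-(2 * N * r ^ 2 / (b - a) ^ 2)) := by
  have hba : b - a ≠ 0 := (sub_pos.2 hab).ne'
  set t := 4 * r / (b - a) ^ 2 with ht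
  have ht0 : 0 ≤ t := by positivity
  calc
    _ ≤ ∑ zs ∈ Fintype.piFinset (fun _ : Fin N => Z),
        Real.exp (-(t * (N * r))) * ∏ j, (p (zs j) * Real.exp (t * f (zs j))) := by
      refine Finset.sum_le_sum fun zs hzs => ?_
      have hP : 0 ≤ ∏ j, p (zs j) :=
        Finset.prod_nonneg fun j _ => hp _ (Fintype.mem_piFinset.1 hzs j)
      rw [Finset.prod_mul_distrib, ← Real.exp_sum, ← Finset.mul_sum, mul_left_comm, ← Real.exp_add]
      split_ifs with h
      · refine le_mul_of_one_le_right hP (Real.one_le_exp ?_)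
        linarith [mul_le_mul_of_nonneg_left h ht0]
      · positivity
    _ = Real.exp (-(t * (N * r))) * (∑ z ∈ Z, p z * Real.exp (t * f z)) ^ N := by
      rw [← Finset.mul_sum,
        ← Finset.prod_univ_sum (fun _ : Fin N => Z) (fun _ z => p z * Real.exp (t * f z))]
      simp
    _ ≤ Real.exp (-(t * (N * r))) * Real.exp (((b - a) / 2) ^ 2 * t ^ 2 / 2) ^ N := by
      gcongr
      · exact Finset.sum_nonneg fun z hz => mul_nonneg (hp z hz) (Real.exp_nonneg _)
      · exact sum_mul_exp_le_of_mem_Icc hp hp1 hf hmean t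
    _ = _ := by
      rw [← Real.exp_nat_mul, ← Real.exp_add, ht]
      congr 1
      field_simp
      ring

/-- If the weights `w` are dominated by `C • w'` and the normalizing constants are within the
stated bounds, then the normalized weights are dominated up to the factor `C * (u / l)`. -/
lemma div_sum_le_mul_div_sum {ι : Type*} [Fintype ι] {w w' : ι → ℝ} {C l u : ℝ}
    (hw' : ∀ k, 0 ≤ w' k) (hC : 0 ≤ C) (hww' : ∀ k, w k ≤ C * w' k)
    (hl : 0 < l) (hlw : l ≤ ∑ k, w k) (hu : ∑ k, w' k ≤ u) (k : ι) :
    w k / ∑ i, w i ≤ C * (u / l) * (w' k / ∑ i, w' i) := by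
  have hS : 0 < ∑ i, w' i := by
    have h : ∑ i, w i ≤ C * ∑ i, w' i := by
      rw [Finset.mul_sum]
      exact Finset.sum_le_sum fun i _ => hww' i
    exact pos_of_mul_pos_right (hl.trans_le (hlw.trans h)) hC
  have hk := hw' k
  calc
    w k / ∑ i, w i ≤ C * w' k / ∑ i, w i := by
      gcongr
      · exact hl.le.trans hlw
      · exact hww' k
    _ ≤ C * w' k / l := by gcongr
    _ = C * w' k / l * ((∑ i, w' i) / ∑ i, w' i) := by rw [div_self hS.ne', mul_one]
    _ ≤ C * w' k / l * (u / ∑ i, w' i) := by gcongr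
    _ = _ := by ring

/-- **Theorem 3 (Approximate DP guarantee of MRC).**  Drawing `N` i.i.d. candidates from `p`
and then an index `K` from the MRC distribution `π^mrc_x`, the resulting mechanism
(candidates, index) is `(ε + ε₀, δ)`-LDP, where
`ε₀ = ln((1+a₀)/(1-a₀))` and `a₀ = e^{-c₀}·sqrt((1/2)·ln(2/δ))`, provided `N ≥ e^{2ε+2c₀}`. -/
theorem mrc_approximate_privacy
    {𝒳 τ : Type*} (ε : ℝ) (hε : 0 ≤ ε)
    (Z : Finset τ) (hZ : Z.Nonempty)
    (q : 𝒳 → τ → ℝ) (p : τ → ℝ)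
    (hq0 : ∀ x, ∀ z ∈ Z, 0 ≤ q x z) (hq1 : ∀ x, ∑ z ∈ Z, q x z = 1)
    (hp : ∀ z ∈ Z, 0 < p z) (hp1 : ∑ z ∈ Z, p z = 1)
    (hLDP : ∀ x x', ∀ z ∈ Z, q x z ≤ Real.exp ε * q x' z)
    (hratio : ∀ x, ∀ z ∈ Z, |Real.log (q x z / p z)| ≤ ε)
    (c0 δ : ℝ) (hc0 : 0 ≤ c0) (hδ0 : 0 < δ) (hδ1 : δ ≤ 1)
    (N : ℕ) (hN0 : 0 < N) (hN : (N : ℝ) ≥ Real.exp (2 * ε + 2 * c0))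
    (a0 ε0 : ℝ)
    (ha0 : a0 = Real.exp (-c0) * Real.sqrt ((1 / 2) * Real.log (2 / δ)))
    (ha01 : a0 < 1)
    (hε0 : ε0 = Real.log ((1 + a0) / (1 - a0)))
    (x x' : 𝒳) (A : Set ((Fin N → τ) × Fin N)) :
    (∑ zs ∈ Fintype.piFinset (fun _ : Fin N => Z), ∑ k : Fin N,
        A.indicator
          (fun _ => (∏ j : Fin N, p (zs j)) *
            ((q x (zs k) / p (zs k)) / ∑ k' : Fin N, q x (zs k') / p (zs k')))
          (zs, k))
      ≤ Real.exp (ε + ε0) *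
          (∑ zs ∈ Fintype.piFinset (fun _ : Fin N => Z), ∑ k : Fin N,
            A.indicator
              (fun _ => (∏ j : Fin N, p (zs j)) *
                ((q x' (zs k) / p (zs k)) / ∑ k' : Fin N, q x' (zs k') / p (zs k')))
              (zs, k)) + δ := by
  have ha0' : 0 ≤ a0 := by rw [ha0]; positivity
  have hN' : (0 : ℝ) < N := by exact_mod_cast hN0
  have hexp0 : Real.exp ε0 = (1 + a0) / (1 - a0) := by
    rw [hε0, Real.exp_log (div_pos (by linarith) (by linarith))]
  have hw0 : ∀ y, ∀ z ∈ Z, 0 ≤ q y z / p z := fun y z hz => div_nonneg (hq0 y z hz) (hp z hz).le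
  have hwε : ∀ y, ∀ z ∈ Z, q y z / p z ≤ Real.exp ε := fun y z hz => by
    rcases (hw0 y z hz).eq_or_lt with h | h
    · rw [← h]; positivity
    · exact (Real.log_le_iff_le_exp h).1 (le_of_abs_le (hratio y z hz))
  have hmean : ∀ y, ∑ z ∈ Z, p z * (q y z / p z - 1) = 0 := fun y => by
    rw [← sub_eq_zero.2 ((hq1 y).trans hp1.symm), ← Finset.sum_sub_distrib]
    refine Finset.sum_congr rfl fun z hz => ?_
    have := (hp z hz).ne'
    field_simp
  have htail : Real.exp (-(2 * N * a0 ^ 2 / Real.exp ε ^ 2)) ≤ δ / 2 := by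
    have hlog : 0 ≤ Real.log (2 / δ) := Real.log_nonneg (by rw [le_div_iff₀ hδ0]; linarith)
    rw [← Real.le_log_iff_exp_le (by positivity), ← inv_div 2 δ, Real.log_inv, neg_le_neg_iff,
      le_div_iff₀ (by positivity), ha0, mul_pow, Real.sq_sqrt (by positivity)]
    have h : Real.exp ε ^ 2 ≤ N * Real.exp (-c0) ^ 2 := by
      calc
        Real.exp ε ^ 2 = Real.exp (2 * ε + 2 * c0) * Real.exp (-c0) ^ 2 := by
          simp only [← Real.exp_nat_mul, ← Real.exp_add]
          congr 1
          push_cast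
          ring
        _ ≤ _ := by gcongr
    linarith [mul_le_mul_of_nonneg_left h hlog]
  have hlower := (sum_piFinset_tail_le (Z := Z) (p := p) (f := fun z => -(q x z / p z - 1))
    (a := 1 - Real.exp ε) (b := 1) (r := a0) N (fun z hz => (hp z hz).le) hp1
    (fun z hz => ⟨by linarith [hwε x z hz], by linarith [hw0 x z hz]⟩)
    (by simpa only [mul_neg, Finset.sum_neg_distrib, neg_eq_zero] using hmean x)
    (by linarith [Real.exp_pos ε]) ha0')
  have hupper := (sum_piFinset_tail_le (Z := Z) (p := p) (f := fun z => q x' z / p z - 1)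
    (a := -1) (b := Real.exp ε - 1) (r := a0) N (fun z hz => (hp z hz).le) hp1
    (fun z hz => ⟨by linarith [hw0 x' z hz], by linarith [hwε x' z hz]⟩) (hmean x')
    (by linarith [Real.exp_pos ε]) ha0')
  rw [sub_sub_cancel] at hlower
  rw [sub_neg_eq_add, sub_add_cancel] at hupper
  refine le_trans ?_ (add_le_add_right
    ((add_le_add (hlower.trans htail) (hupper.trans htail)).trans_eq (add_halves δ)) _)
  rw [Finset.mul_sum, ← Finset.sum_add_distrib, ← Finset.sum_add_distrib]
  refine Finset.sum_le_sum fun zs hzs => ?_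
  have hzsZ : ∀ j, zs j ∈ Z := Fintype.mem_piFinset.1 hzs
  have hP : 0 ≤ ∏ j, p (zs j) := Finset.prod_nonneg fun j _ => (hp _ (hzsZ j)).le
  have hrow0 : ∀ y k, 0 ≤ (∏ j, p (zs j)) *
      ((q y (zs k) / p (zs k)) / ∑ k', q y (zs k') / p (zs k')) := fun y k =>
    mul_nonneg hP (div_nonneg (hw0 y _ (hzsZ k)) (Finset.sum_nonneg fun i _ => hw0 y _ (hzsZ i)))
  by_cases hgood : (∑ j, -(q x (zs j) / p (zs j) - 1) < N * a0) ∧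
      (∑ j, (q x' (zs j) / p (zs j) - 1) < N * a0)
  · rw [if_neg hgood.1.not_ge, if_neg hgood.2.not_ge, add_zero, add_zero, Finset.mul_sum]
    obtain ⟨h1, h2⟩ := hgood
    simp only [Finset.sum_neg_distrib, Finset.sum_sub_distrib, Finset.sum_const, Finset.card_univ,
      Fintype.card_fin, nsmul_eq_mul, mul_one] at h1 h2
    refine Finset.sum_le_sum fun k _ => ?_
    by_cases hA : (zs, k) ∈ A
    · rw [Set.indicator_of_mem hA, Set.indicator_of_mem hA, mul_left_comm]
      refine mul_le_mul_of_nonneg_left ?_ hP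
      have h := div_sum_le_mul_div_sum (w := fun k => q x (zs k) / p (zs k))
        (w' := fun k => q x' (zs k) / p (zs k)) (C := Real.exp ε) (l := N * (1 - a0))
        (u := N * (1 + a0)) (fun k => hw0 x' _ (hzsZ k)) (Real.exp_nonneg ε)
        (fun k => by
          rw [← mul_div_assoc]
          exact div_le_div_of_nonneg_right (hLDP x x' _ (hzsZ k)) (hp _ (hzsZ k)).le)
        (mul_pos hN' (by linarith)) (by linarith) (by linarith) k
      rwa [mul_div_mul_left _ _ hN'.ne', ← hexp0, ← Real.exp_add] at h
    · rw [Set.indicator_of_notMem hA, Set.indicator_of_notMem hA, mul_zero]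
  · have hrow : ∑ k, A.indicator (fun _ => (∏ j, p (zs j)) *
        ((q x (zs k) / p (zs k)) / ∑ k', q x (zs k') / p (zs k'))) (zs, k) ≤ ∏ j, p (zs j) := by
      refine (Finset.sum_le_sum fun k _ =>
        Set.indicator_le_self' (fun _ _ => hrow0 x k) (zs, k)).trans ?_
      rw [← Finset.mul_sum, ← Finset.sum_div]
      exact mul_le_of_le_one_right hP (div_self_le_one _)
    have hrhs : 0 ≤ Real.exp (ε + ε0) * ∑ k, A.indicator (fun _ => (∏ j, p (zs j)) *
        ((q x' (zs k) / p (zs k)) / ∑ k', q x' (zs k') / p (zs k'))) (zs, k) :=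
      mul_nonneg (Real.exp_nonneg _) (Finset.sum_nonneg fun k _ =>
        Set.indicator_nonneg (fun _ _ => hrow0 x' k) _)
    refine (hrow.trans ?_).trans (le_add_of_nonneg_left hrhs)
    rcases not_and_or.1 hgood with h | h
    · rw [if_pos (not_lt.1 h)]
      exact le_add_of_nonneg_right (by split_ifs <;> simp [hP])
    · rw [if_pos (not_lt.1 h)]
      exact le_add_of_nonneg_left (by split_ifs <;> simp [hP])
end

section
/- Let ε ≥ 0 and let q be a cap-based ε-LDP family on a finite set 𝒵 with constants c1 ≥ c2 > 0, c1 ≤ e^ε·c2, and cap proportion μ. Then for every N ≥ 1, all candidates z_1,…,z_N ∈ 𝒵 and every datum x, each value π^mmrc_x(k) lies in the interval [t_l, t_u]; consequently, for all x, x' ∈ 𝒳 and every k ∈ {1,…,N}: π^mmrc_x(k) ≤ e^ε·π^mmrc_{x'}(k), i.e., the MMRC index distribution is ε-locally differentially private. -/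
open scoped Classical
open Real Finset

noncomputable section

/-- The MMRC index distribution for a cap-based mechanism with in-cap value `c1`,
out-cap value `c2`, cap proportion `μ`, cap membership predicate `inCap` and
candidates `zs : Fin N → τ`. -/
def mmrcPi {τ : Type*} (c1 c2 μ : ℝ) (inCap : τ → Prop) {N : ℕ}
    (zs : Fin N → τ) (k : Fin N) : ℝ :=
  let θ : ℝ := ((Finset.univ.filter fun j : Fin N => inCap (zs j)).card : ℝ) / (N : ℝ)
  let a : ℝ := μ * c1 + (1 - μ) * c2
  let tu : ℝ := c1 / ((N : ℝ) * a)
  let tl : ℝ := c2 / ((N : ℝ) * a)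
  if θ < μ then
    (if inCap (zs k) then tu else (1 - (N : ℝ) * θ * tu) / ((N : ℝ) * (1 - θ)))
  else if μ < θ then
    (if inCap (zs k) then (1 - (N : ℝ) * (1 - θ) * tl) / ((N : ℝ) * θ) else tl)
  else
    (if inCap (zs k) then c1 / ((N : ℝ) * (θ * c1 + (1 - θ) * c2))
     else c2 / ((N : ℝ) * (θ * c1 + (1 - θ) * c2)))

/-- If the cap proportion `μ` lies in `(0, 1]`, every MMRC index mass lies between the
lower threshold `c2 / (N a)` and the upper threshold `c1 / (N a)`, where
`a = μ c1 + (1 - μ) c2`. -/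
theorem mmrcPi_mem_Icc {τ : Type*} {c1 c2 μ : ℝ} (hc2 : 0 < c2) (hc12 : c2 ≤ c1)
    (hμ0 : 0 < μ) (hμ1 : μ ≤ 1) (inCap : τ → Prop) {N : ℕ} (hN : 1 ≤ N)
    (zs : Fin N → τ) (k : Fin N) :
    mmrcPi c1 c2 μ inCap zs k ∈ Set.Icc (c2 / ((N : ℝ) * (μ * c1 + (1 - μ) * c2)))
      (c1 / ((N : ℝ) * (μ * c1 + (1 - μ) * c2))) := by
  have hN0 : (0 : ℝ) < N := by exact_mod_cast hN
  have ha2 : c2 ≤ μ * c1 + (1 - μ) * c2 := by nlinarith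
  have ha1 : μ * c1 + (1 - μ) * c2 ≤ c1 := by nlinarith
  unfold mmrcPi
  extract_lets θ a tu tl
  have ha : 0 < a := hc2.trans_le ha2
  have hNa : 0 < (N : ℝ) * a := mul_pos hN0 ha
  have hlu : tl ≤ tu := div_le_div_of_nonneg_right hc12 hNa.le
  change _ ∈ Set.Icc tl tu
  split_ifs with hlt hk hgt hk hk
  · exact ⟨hlu, le_rfl⟩
  · have hθ : 0 < 1 - θ := by linarith
    have hu : (N : ℝ) * θ * tu = θ * c1 / a := by simp only [tu]; field_simp
    have hmass : (1 - (N : ℝ) * θ * tu) / ((N : ℝ) * (1 - θ))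
        = (a - θ * c1) / (1 - θ) / ((N : ℝ) * a) := by rw [hu]; field_simp
    rw [hmass]
    constructor
    · refine div_le_div_of_nonneg_right ?_ hNa.le
      rw [le_div_iff₀ hθ]
      simp only [a]
      nlinarith
    · refine div_le_div_of_nonneg_right ?_ hNa.le
      rw [div_le_iff₀ hθ]
      linarith
  · have hθ : 0 < θ := hμ0.trans hgt
    have hl : (N : ℝ) * (1 - θ) * tl = (1 - θ) * c2 / a := by simp only [tl]; field_simp
    have hmass : (1 - (N : ℝ) * (1 - θ) * tl) / ((N : ℝ) * θ)
        = (a - (1 - θ) * c2) / θ / ((N : ℝ) * a) := by rw [hl]; field_simp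
    rw [hmass]
    constructor
    · refine div_le_div_of_nonneg_right ?_ hNa.le
      rw [le_div_iff₀ hθ]
      linarith
    · refine div_le_div_of_nonneg_right ?_ hNa.le
      rw [div_le_iff₀ hθ]
      simp only [a]
      nlinarith
  · exact ⟨le_rfl, hlu⟩
  · rw [le_antisymm (not_lt.mp hgt) (not_lt.mp hlt)]
    exact ⟨hlu, le_rfl⟩
  · rw [le_antisymm (not_lt.mp hgt) (not_lt.mp hlt)]
    exact ⟨le_rfl, hlu⟩

/-- **Theorem 4 (DP guarantee of MMRC).**  For a cap-based `ε`-LDP family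
(`c1 ≥ c2 > 0`, `c1 ≤ e^ε·c2`, cap proportion `μ ≥ c2/(2c1)` independent of the datum),
every MMRC index mass lies in `[t_l, t_u]`, and consequently the MMRC index distribution
is `ε`-LDP. -/
theorem mmrc_privacy
    {𝒳 τ : Type*} (ε : ℝ) (hε : 0 ≤ ε)
    (Z : Finset τ) (hZ : Z.Nonempty)
    (c1 c2 μ : ℝ) (hc2 : 0 < c2) (hc12 : c2 ≤ c1) (hc1e : c1 ≤ Real.exp ε * c2)
    (hμl : c2 / (2 * c1) ≤ μ)
    (Cap : 𝒳 → Finset τ) (hCapZ : ∀ x, Cap x ⊆ Z)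
    (hCapCard : ∀ x, ((Cap x).card : ℝ) = μ * (Z.card : ℝ))
    (N : ℕ) (hN : 1 ≤ N)
    (zs : Fin N → τ) (hzs : ∀ k, zs k ∈ Z) :
    (∀ (x : 𝒳) (k : Fin N),
        c2 / ((N : ℝ) * (μ * c1 + (1 - μ) * c2)) ≤ mmrcPi c1 c2 μ (· ∈ Cap x) zs k ∧
        mmrcPi c1 c2 μ (· ∈ Cap x) zs k ≤ c1 / ((N : ℝ) * (μ * c1 + (1 - μ) * c2)))
    ∧ (∀ (x x' : 𝒳) (k : Fin N),
        mmrcPi c1 c2 μ (· ∈ Cap x) zs k ≤ Real.exp ε * mmrcPi c1 c2 μ (· ∈ Cap x') zs k) := by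
  have hμ0 : 0 < μ := (div_pos hc2 (by linarith)).trans_le hμl
  have hμ1 (x : 𝒳) : μ ≤ 1 := by
    have hZ0 : (0 : ℝ) < Z.card := by exact_mod_cast hZ.card_pos
    have hle : ((Cap x).card : ℝ) ≤ Z.card := by exact_mod_cast card_le_card (hCapZ x)
    rw [hCapCard] at hle
    nlinarith
  have hmem (x : 𝒳) (k : Fin N) :=
    mmrcPi_mem_Icc hc2 hc12 hμ0 (hμ1 x) (· ∈ Cap x) hN zs k
  refine ⟨hmem, fun x x' k => ?_⟩
  have ha : 0 ≤ μ * c1 + (1 - μ) * c2 := by nlinarith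
  calc mmrcPi c1 c2 μ (· ∈ Cap x) zs k
      ≤ c1 / ((N : ℝ) * (μ * c1 + (1 - μ) * c2)) := (hmem x k).2
    _ ≤ Real.exp ε * c2 / ((N : ℝ) * (μ * c1 + (1 - μ) * c2)) := by gcongr
    _ = Real.exp ε * (c2 / ((N : ℝ) * (μ * c1 + (1 - μ) * c2))) := mul_div_assoc _ _ _
    _ ≤ Real.exp ε * mmrcPi c1 c2 μ (· ∈ Cap x') zs k := by
        gcongr
        exact (hmem x' k).1
end
end

section
/- Let ε ≥ 0, let 𝒳 and a nonempty finite set 𝒵 be subsets of ℝ^m, and let q be a cap-based ε-LDP family on 𝒵 with constants c1 ≥ c2 > 0, c1 ≤ e^ε·c2, and cap proportion μ ≥ c2/(2c1). Fix x ∈ 𝒳 ⊆ ℝ^m. Let ρ ∈ (0,1) and let N be a positive integer with N ≥ 2(e^ε−1)²·ln(2/ρ)/ρ². Draw candidates Z_1,…,Z_N i.i.d. uniformly from 𝒵; given the candidates, draw K^mrc from π^mrc_x (with uniform reference, so π^mrc_x(k) ∝ q(Z_k|x)) and K^mmrc from π^mmrc_x. Then E[‖Z_{K^mmrc} − x‖²]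 ≤ E[‖Z_{K^mrc} − x‖²] + sqrt(ρ·(1+ε)/2)·max_{z ∈ 𝒵} ‖z − x‖², where both expectations are over the candidates and the selected index. -/
open scoped Classical
open Real Finset

noncomputable section

/-- The MRC index distribution for a cap-based mechanism with uniform reference:
`π^mrc_x(k) ∝ q(z_k|x)`, where `q(z|x) = c1` in-cap and `c2` out-cap. -/
def mrcCapPi {τ : Type*} (c1 c2 : ℝ) (inCap : τ → Prop) {N : ℕ}
    (zs : Fin N → τ) (k : Fin N) : ℝ :=
  (if inCap (zs k) then c1 else c2) / ∑ k' : Fin N, (if inCap (zs k') then c1 else c2)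

/-- The variance identity for a sum of i.i.d. centred functions of uniform samples from `s`. -/
lemma sum_piFinset_sq_sum {τ : Type*} (s : Finset τ) (f : τ → ℝ) (hf : ∑ z ∈ s, f z = 0)
    (N : ℕ) :
    ∑ zs ∈ Fintype.piFinset (fun _ : Fin N => s), (∑ k, f (zs k)) ^ 2
      = N * ((s.card : ℝ) ^ (N - 1) * ∑ z ∈ s, f z ^ 2) := by
  have offDiag (i j : Fin N) (hij : i ≠ j) :
      ∑ zs ∈ Fintype.piFinset (fun _ : Fin N => s), f (zs i) * f (zs j) = 0 := by
    have h := Finset.prod_univ_sum (fun _ : Fin N => s)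
      (fun k z => (if k = i then f z else 1) * (if k = j then f z else 1))
    simp only [Finset.prod_mul_distrib, Finset.prod_ite_eq', Finset.mem_univ, if_true] at h
    rw [← h]
    refine Finset.prod_eq_zero (Finset.mem_univ i) ?_
    simp [hij, hf]
  have diag (i : Fin N) :
      ∑ zs ∈ Fintype.piFinset (fun _ : Fin N => s), f (zs i) * f (zs i)
        = (s.card : ℝ) ^ (N - 1) * ∑ z ∈ s, f z ^ 2 := by
    simpa [sq] using Fintype.sum_piFinset_apply (fun z => f z * f z) s i
  simp only [sq (∑ k, _), Finset.sum_mul_sum]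
  rw [Finset.sum_comm]
  simp_rw [Finset.sum_comm (s := Fintype.piFinset _)]
  rw [Finset.sum_congr rfl fun i _ =>
    (Finset.sum_eq_single i (fun j _ hj => offDiag i j hj.symm) (by simp)).trans (diag i)]
  simp

section Pointwise

variable {τ : Type*} {c1 c2 μ : ℝ} {P : τ → Prop} {N : ℕ} (zs : Fin N → τ)

lemma sum_ite_cap :
    ∑ k : Fin N, (if P (zs k) then c1 else c2)
      = ((univ.filter fun j => P (zs j)).card : ℝ) * c1
        + ((N : ℝ) - (univ.filter fun j => P (zs j)).card) * c2 := by
  have h : ∀ k, (if P (zs k) then c1 else c2) = c2 + (if P (zs k) then c1 - c2 else 0) := by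
    intro k; split_ifs <;> ring
  simp_rw [h, Finset.sum_add_distrib, ← Finset.sum_filter]
  simp
  ring

lemma mmrcPi_le_mrcCapPi_of_mem (hc2 : 0 < c2) (hc12 : c2 ≤ c1) (hμ0 : 0 ≤ μ)
    (k : Fin N) (hk : P (zs k)) : mmrcPi c1 c2 μ P zs k ≤ mrcCapPi c1 c2 P zs k := by
  have hN : (0 : ℝ) < N := by exact_mod_cast k.pos
  have hn0 : (0 : ℝ) < ((univ.filter fun j => P (zs j)).card : ℝ) := by
    exact_mod_cast Finset.card_pos.2 ⟨k, by simpa using hk⟩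
  have hnN : ((univ.filter fun j => P (zs j)).card : ℝ) ≤ N := by
    exact_mod_cast (Finset.card_filter_le _ _).trans (by simp)
  simp only [mmrcPi, mrcCapPi, sum_ite_cap, hk, if_true]
  generalize ((univ.filter fun j => P (zs j)).card : ℝ) = n at *
  obtain ⟨θ, rfl⟩ : ∃ θ, n = N * θ := ⟨n / N, by field_simp⟩
  rw [mul_div_cancel_left₀ _ hN.ne']
  have hθ0 : 0 < θ := pos_of_mul_pos_right hn0 hN.le
  have hθ1 : θ ≤ 1 := by nlinarith
  have ha : 0 < μ * c1 + (1 - μ) * c2 := by nlinarith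
  have hb : 0 < θ * c1 + (1 - θ) * c2 := by nlinarith
  have hB : N * θ * c1 + (N - N * θ) * c2 = N * (θ * c1 + (1 - θ) * c2) := by ring
  rw [hB]
  split_ifs with h1 h2
  · refine div_le_div_of_nonneg_left (by linarith) (mul_pos hN hb) ?_
    exact mul_le_mul_of_nonneg_left (by nlinarith) hN.le
  · have : c1 / (N * (θ * c1 + (1 - θ) * c2))
        = (1 - N * (1 - θ) * (c2 / (N * (θ * c1 + (1 - θ) * c2)))) / (N * θ) := by
      have hbdef : θ * c1 = (θ * c1 + (1 - θ) * c2) - (1 - θ) * c2 := by ring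
      generalize θ * c1 + (1 - θ) * c2 = b at *
      field_simp
      linear_combination hbdef
    rw [this]
    have hba : μ * c1 + (1 - μ) * c2 ≤ θ * c1 + (1 - θ) * c2 := by nlinarith
    have h1θ : 0 ≤ 1 - θ := by linarith
    gcongr
  · rfl

lemma mmrcPi_sub_mrcCapPi_le_of_notMem (hc2 : 0 < c2) (hc12 : c2 ≤ c1) (hμ0 : 0 ≤ μ)
    (k : Fin N) (hk : ¬ P (zs k)) :
    mmrcPi c1 c2 μ P zs k - mrcCapPi c1 c2 P zs k
      ≤ (c1 - c2) / c2 * |((univ.filter fun j => P (zs j)).card : ℝ) / N - μ|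
        / ((univ.filter fun j => ¬ P (zs j)).card : ℝ) := by
  have hN : (0 : ℝ) < N := by exact_mod_cast k.pos
  have hn0 : (0 : ℝ) ≤ ((univ.filter fun j => P (zs j)).card : ℝ) := by positivity
  have hm0 : (0 : ℝ) < ((univ.filter fun j => ¬ P (zs j)).card : ℝ) := by
    exact_mod_cast Finset.card_pos.2 ⟨k, by simpa using hk⟩
  have hm : ((univ.filter fun j => ¬ P (zs j)).card : ℝ)
      = N - (univ.filter fun j => P (zs j)).card := by
    have h := Finset.card_filter_add_card_filter_not (s := (univ : Finset (Fin N)))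
      (fun j => P (zs j))
    rw [Finset.card_univ, Fintype.card_fin] at h
    have h' : ((univ.filter fun j => P (zs j)).card : ℝ)
        + (univ.filter fun j => ¬ P (zs j)).card = N := by exact_mod_cast h
    linarith
  rw [hm] at hm0 ⊢
  simp only [mmrcPi, mrcCapPi, sum_ite_cap, hk, if_false]
  generalize ((univ.filter fun j => P (zs j)).card : ℝ) = n at *
  obtain ⟨θ, rfl⟩ : ∃ θ, n = N * θ := ⟨n / N, by field_simp⟩
  rw [mul_div_cancel_left₀ _ hN.ne']
  have hθ0 : 0 ≤ θ := nonneg_of_mul_nonneg_right hn0 hN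
  have hθ1 : 0 < 1 - θ := by nlinarith
  have ha2 : c2 ≤ μ * c1 + (1 - μ) * c2 := by nlinarith
  have hb2 : c2 ≤ θ * c1 + (1 - θ) * c2 := by nlinarith
  have hB : N * θ * c1 + (N - N * θ) * c2 = N * (θ * c1 + (1 - θ) * c2) := by ring
  have hC : N - N * θ = N * (1 - θ) := by ring
  have hba : (θ * c1 + (1 - θ) * c2) - (μ * c1 + (1 - μ) * c2) = (c1 - c2) * (θ - μ) := by ring
  have hbin : θ * c1 ≤ θ * c1 + (1 - θ) * c2 := by nlinarith
  have hbout : (1 - θ) * c2 ≤ θ * c1 + (1 - θ) * c2 := by nlinarith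
  have hbdef : θ * c1 = (θ * c1 + (1 - θ) * c2) - (1 - θ) * c2 := by ring
  rw [hB, hC]
  generalize μ * c1 + (1 - μ) * c2 = a at *
  generalize θ * c1 + (1 - θ) * c2 = b at *
  have ha : 0 < a := by linarith
  have hb : 0 < b := by linarith
  split_ifs with h1 h2
  · have hD : 0 ≤ (c1 - c2) * (μ - θ) := mul_nonneg (by linarith) (by linarith)
    have key : (1 - N * θ * (c1 / (N * a))) / (N * (1 - θ)) - c2 / (N * b)
        = (θ * c1) / b * (((c1 - c2) * (μ - θ)) / a) / (N * (1 - θ)) := by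
      have : (c1 - c2) * (μ - θ) = a - b := by linarith
      rw [this]
      field_simp
      linear_combination (-a) * hbdef
    rw [key, abs_of_neg (by linarith)]
    refine div_le_div_of_nonneg_right ?_ (mul_pos hN hθ1).le
    calc (θ * c1) / b * (((c1 - c2) * (μ - θ)) / a)
        ≤ 1 * (((c1 - c2) * (μ - θ)) / c2) := by
          gcongr
          exact (div_le_one hb).2 hbin
      _ = (c1 - c2) / c2 * -(θ - μ) := by ring
  · have hD : 0 ≤ (c1 - c2) * (θ - μ) := mul_nonneg (by linarith) (by linarith)
    have key : c2 / (N * a) - c2 / (N * b)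
        = ((1 - θ) * c2) / b * (((c1 - c2) * (θ - μ)) / a) / (N * (1 - θ)) := by
      rw [← hba]
      field_simp
    rw [key, abs_of_pos (by linarith)]
    refine div_le_div_of_nonneg_right ?_ (mul_pos hN hθ1).le
    calc ((1 - θ) * c2) / b * (((c1 - c2) * (θ - μ)) / a)
        ≤ 1 * (((c1 - c2) * (θ - μ)) / c2) := by
          gcongr
          exact (div_le_one hb).2 hbout
      _ = (c1 - c2) / c2 * (θ - μ) := by ring
  · rw [sub_self]
    have : 0 ≤ c1 - c2 := by linarith
    positivity

/-- For fixed candidates, MMRC and MRC expectations differ by at most the total variation bound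
`(c1 - c2) / c2 * |θ - μ|`, scaled by the range of the integrand. -/
lemma sum_mmrcPi_mul_le (hc2 : 0 < c2) (hc12 : c2 ≤ c1) (hμ0 : 0 ≤ μ)
    (d : Fin N → ℝ) (M : ℝ) (hM : 0 ≤ M) (hd0 : ∀ k, 0 ≤ d k) (hdM : ∀ k, d k ≤ M) :
    ∑ k, mmrcPi c1 c2 μ P zs k * d k ≤ ∑ k, mrcCapPi c1 c2 P zs k * d k
      + (c1 - c2) / c2 * |((univ.filter fun j => P (zs j)).card : ℝ) / N - μ| * M := by
  have hsub := mmrcPi_sub_mrcCapPi_le_of_notMem (P := P) zs hc2 hc12 hμ0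
  set T := (c1 - c2) / c2 * |((univ.filter fun j => P (zs j)).card : ℝ) / N - μ|
  have hT : 0 ≤ T := mul_nonneg (div_nonneg (by linarith) hc2.le) (abs_nonneg _)
  set m : ℝ := ((univ.filter fun j => ¬ P (zs j)).card : ℝ)
  have hm : 0 ≤ m := Nat.cast_nonneg _
  have hTm : 0 ≤ T / m * M := by positivity
  have hk (k : Fin N) : mmrcPi c1 c2 μ P zs k * d k - mrcCapPi c1 c2 P zs k * d k
      ≤ if ¬ P (zs k) then T / m * M else 0 := by
    rw [← sub_mul]
    split_ifs with h
    · exact mul_nonpos_of_nonpos_of_nonneg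
        (sub_nonpos.2 (mmrcPi_le_mrcCapPi_of_mem zs hc2 hc12 hμ0 k h)) (hd0 k)
    · exact (mul_le_mul_of_nonneg_right (hsub k h) (hd0 k)).trans
        (mul_le_mul_of_nonneg_left (hdM k) (by positivity))
  have hsum := Finset.sum_le_sum fun k (_ : k ∈ univ) => hk k
  rw [Finset.sum_sub_distrib, ← Finset.sum_filter, Finset.sum_const, nsmul_eq_mul] at hsum
  have : m * (T / m * M) ≤ T * M := by
    rw [← mul_assoc]
    refine mul_le_mul_of_nonneg_right ?_ hM
    rcases hm.eq_or_lt with h | h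
    · rw [← h]; simpa using hT
    · rw [mul_div_cancel₀ _ h.ne']
  linarith

end Pointwise

/-- **Theorem 5 (Utility of MMRC).**  For a cap-based `ε`-LDP mechanism and
`N ≥ 2(e^ε−1)²·ln(2/ρ)/ρ²` i.i.d. uniform candidates, the expected squared error of the
MMRC-selected candidate exceeds that of the MRC-selected candidate by at most
`sqrt(ρ(1+ε)/2)·max_{z∈𝒵}‖z−x‖²`. -/
theorem mmrc_utility
    (m : ℕ) (ε : ℝ) (hε : 0 ≤ ε)
    (Z : Finset (EuclideanSpace ℝ (Fin m))) (hZ : Z.Nonempty)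
    (Cap : Finset (EuclideanSpace ℝ (Fin m))) (hCap : Cap ⊆ Z)
    (c1 c2 μ : ℝ) (hc2 : 0 < c2) (hc12 : c2 ≤ c1) (hc1e : c1 ≤ Real.exp ε * c2)
    (hμl : c2 / (2 * c1) ≤ μ) (hμcard : ((Cap.card : ℝ)) = μ * (Z.card : ℝ))
    (x : EuclideanSpace ℝ (Fin m))
    (ρ : ℝ) (hρ0 : 0 < ρ) (hρ1 : ρ < 1)
    (N : ℕ) (hN0 : 0 < N)
    (hN : (N : ℝ) ≥ 2 * (Real.exp ε - 1) ^ 2 * Real.log (2 / ρ) / ρ ^ 2) :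
    (∑ zs ∈ Fintype.piFinset (fun _ : Fin N => Z),
        (1 / (Z.card : ℝ)) ^ N * ∑ k : Fin N, mmrcPi c1 c2 μ (· ∈ Cap) zs k * ‖zs k - x‖ ^ 2)
      ≤ (∑ zs ∈ Fintype.piFinset (fun _ : Fin N => Z),
          (1 / (Z.card : ℝ)) ^ N * ∑ k : Fin N, mrcCapPi c1 c2 (· ∈ Cap) zs k * ‖zs k - x‖ ^ 2)
        + Real.sqrt (ρ * (1 + ε) / 2) * Z.sup' hZ (fun z => ‖z - x‖ ^ 2) := by
  set M := Z.sup' hZ (fun z => ‖z - x‖ ^ 2)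
  set s := Real.sqrt (ρ * (1 + ε) / 2)
  have hM0 : 0 ≤ M :=
    (sq_nonneg _).trans (Finset.le_sup' (fun z => ‖z - x‖ ^ 2) hZ.choose_spec)
  have hs : 0 < s := Real.sqrt_pos.2 (by positivity)
  have hs2 : s ^ 2 = ρ * (1 + ε) / 2 := Real.sq_sqrt (by positivity)
  have hZ0 : (0 : ℝ) < Z.card := by exact_mod_cast hZ.card_pos
  have hNr : (0 : ℝ) < N := by exact_mod_cast hN0
  have hc1 : 0 < c1 := hc2.trans_le hc12
  have hμ0 : 0 ≤ μ := le_trans (by positivity) hμl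
  set R := (c1 - c2) / c2
  have hR0 : 0 ≤ R := div_nonneg (by linarith) hc2.le
  have hRe : R ≤ Real.exp ε - 1 := by
    rw [div_le_iff₀ hc2]; linarith
  let f : EuclideanSpace ℝ (Fin m) → ℝ := fun z => (if z ∈ Cap then 1 else 0) - μ
  have hind : ∑ z ∈ Z, (if z ∈ Cap then (1 : ℝ) else 0) = μ * Z.card := by
    rw [← hμcard, Finset.sum_boole, Finset.filter_mem_eq_inter, Finset.inter_eq_right.2 hCap]
  have hf : ∑ z ∈ Z, f z = 0 := by
    simp only [f, Finset.sum_sub_distrib, hind, Finset.sum_const, nsmul_eq_mul]; ring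
  have hf2 : ∑ z ∈ Z, f z ^ 2 ≤ Z.card / 4 := by
    have h (z) : f z ^ 2 = (1 - 2 * μ) * (if z ∈ Cap then (1 : ℝ) else 0) + μ ^ 2 := by
      simp only [f]; split_ifs <;> ring
    simp only [h, Finset.sum_add_distrib, ← Finset.mul_sum, hind, Finset.sum_const, nsmul_eq_mul]
    nlinarith [mul_nonneg hZ0.le (sq_nonneg (2 * μ - 1))]
  have hθ (zs : Fin N → EuclideanSpace ℝ (Fin m)) (inst : DecidablePred fun j => zs j ∈ Cap) :
      ((univ.filter fun j => zs j ∈ Cap).card : ℝ) / N - μ = (∑ k, f (zs k)) / N := by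
    simp only [f, Finset.sum_sub_distrib, Finset.sum_const, nsmul_eq_mul,
      Finset.card_univ, Fintype.card_fin, sub_div, mul_div_cancel_left₀ _ hNr.ne']
    rw [Finset.card_filter]
    push_cast
    congr!
  have hpt : ∀ zs ∈ Fintype.piFinset (fun _ : Fin N => Z),
      (1 / (Z.card : ℝ)) ^ N * ∑ k, mmrcPi c1 c2 μ (· ∈ Cap) zs k * ‖zs k - x‖ ^ 2
      ≤ (1 / (Z.card : ℝ)) ^ N * ∑ k, mrcCapPi c1 c2 (· ∈ Cap) zs k * ‖zs k - x‖ ^ 2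
        + (1 / (Z.card : ℝ)) ^ N *
          (M * R ^ 2 / (2 * s * N ^ 2) * (∑ k, f (zs k)) ^ 2 + M * s / 2) := by
    intro zs hzs
    rw [← mul_add]
    refine mul_le_mul_of_nonneg_left ?_ (by positivity)
    refine (sum_mmrcPi_mul_le (P := (· ∈ Cap)) zs hc2 hc12 hμ0 (fun k => ‖zs k - x‖ ^ 2) M hM0
      (fun k => sq_nonneg _) fun k =>
        Finset.le_sup' (fun z => ‖z - x‖ ^ 2) (Fintype.mem_piFinset.1 hzs k)).trans ?_
    refine add_le_add_right ?_ _
    rw [hθ]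
    have amgm (t : ℝ) : t ≤ t ^ 2 / (2 * s) + s / 2 := by
      have : t ^ 2 / (2 * s) + s / 2 - t = (t - s) ^ 2 / (2 * s) := by field_simp; ring
      have : 0 ≤ (t - s) ^ 2 / (2 * s) := by positivity
      linarith
    calc R * |(∑ k, f (zs k)) / N| * M
        ≤ ((R * |(∑ k, f (zs k)) / N|) ^ 2 / (2 * s) + s / 2) * M :=
          mul_le_mul_of_nonneg_right (amgm _) hM0
      _ = _ := by rw [mul_pow, sq_abs]; field_simp
  refine (Finset.sum_le_sum hpt).trans ?_
  rw [Finset.sum_add_distrib, ← Finset.mul_sum (Fintype.piFinset _) (fun zs => _ + _),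
    Finset.sum_add_distrib,
    ← Finset.mul_sum (Fintype.piFinset _) (fun zs => (∑ k, f (zs k)) ^ 2), sum_piFinset_sq_sum Z f hf]
  refine add_le_add_right ?_ _
  rw [Finset.sum_const, Fintype.card_piFinset_const, nsmul_eq_mul]
  obtain ⟨n, rfl⟩ : ∃ n, N = n + 1 := ⟨N - 1, by omega⟩
  have hlog : 1 / 2 ≤ Real.log (2 / ρ) := by
    have : Real.log 2 ≤ Real.log (2 / ρ) :=
      Real.log_le_log (by norm_num) (by rw [le_div_iff₀ hρ0]; linarith)
    linarith [Real.log_two_gt_d9]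
  have hRN : R ^ 2 ≤ 4 * s ^ 2 * ((n + 1 : ℕ) : ℝ) := by
    have h1 := (div_le_iff₀ (by positivity : (0 : ℝ) < ρ ^ 2)).1 hN
    have h2 : R ^ 2 ≤ (Real.exp ε - 1) ^ 2 := pow_le_pow_left₀ hR0 hRe 2
    have h3 : ρ ^ 2 ≤ 4 * s ^ 2 := by rw [hs2]; nlinarith
    nlinarith [mul_le_mul_of_nonneg_left hlog (sq_nonneg (Real.exp ε - 1)),
      mul_le_mul_of_nonneg_right h3 hNr.le]
  have hvar : ((Z.card : ℝ)) ^ n * ∑ z ∈ Z, f z ^ 2 ≤ (Z.card : ℝ) ^ (n + 1) / 4 := by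
    calc _ ≤ (Z.card : ℝ) ^ n * (Z.card / 4) := by gcongr
      _ = _ := by ring
  calc _ ≤ (1 / (Z.card : ℝ)) ^ (n + 1) * (M * (4 * s ^ 2 * ((n + 1 : ℕ) : ℝ))
            / (2 * s * ((n + 1 : ℕ) : ℝ) ^ 2)
          * (((n + 1 : ℕ) : ℝ) * ((Z.card : ℝ) ^ (n + 1) / 4))
          + (((Z.card) ^ (n + 1) : ℕ) : ℝ) * (M * s / 2)) := by
        rw [Nat.add_sub_cancel]
        gcongr
    _ = s * M := by
        push_cast
        rw [div_pow, one_pow]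
        field_simp
        ring
end
end

section
/- Fix an integer d ≥ 2, a real ε with 1 ≤ ε ≤ d−1, a real λ > 0, and a positive integer N with N ≥ 2(e^ε+1)²(1+λ)²/(0.24²·λ²)·ln(8(1+λ)/(0.24·λ)). For n users with one-hot inputs x_1,…,x_n ∈ {0,1}^d processed independently, let r_FE(mechanism) := max over (x_1,…,x_n) of E‖(1/n)Σ_{i=1}^n x̂_i − (1/n)Σ_{i=1}^n x_i‖², where x̂_i is the mechanism's estimate for user i. Then r_FE of MMRC simulating Subset Selection (with estimator x̂^mmrc) is at most (1+4λ+5λ²+2λ³) times r_FE of Subset Selection (with estimator x̂^ss). -/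
open scoped Classical
open Real Finset

noncomputable section

/-- The output alphabet of Subset Selection: subsets of `[d]` of size `s`. -/
def zset (d s : ℕ) : Finset (Finset (Fin d)) := Finset.powersetCard s Finset.univ

/-- Normalizing constant of the Subset Selection pmf. -/
def qssC (d s : ℕ) (ε : ℝ) : ℝ :=
  ((d - 1).choose (s - 1) : ℝ) * Real.exp ε + ((d - 1).choose s : ℝ)

/-- The Subset Selection pmf `q^ss(A | e_j)`. -/
def qss (d s : ℕ) (ε : ℝ) (j : Fin d) (A : Finset (Fin d)) : ℝ :=
  if j ∈ A then Real.exp ε / qssC d s ε else 1 / qssC d s ε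

/-- Subset Selection scaling factor `m_ss`. -/
def mss (d s : ℕ) (ε : ℝ) : ℝ :=
  (s : ℝ) * ((d : ℝ) - (s : ℝ)) * (Real.exp ε - 1) /
    (((d : ℝ) - 1) * ((s : ℝ) * (Real.exp ε - 1) + (d : ℝ)))

/-- Subset Selection offset `b_ss`. -/
def bss (d s : ℕ) (ε : ℝ) : ℝ :=
  (s : ℝ) * (((s : ℝ) - 1) * Real.exp ε + ((d : ℝ) - (s : ℝ))) /
    (((d : ℝ) - 1) * ((s : ℝ) * (Real.exp ε - 1) + (d : ℝ)))

/-- The Subset Selection estimator `x̂^ss = (z − b_ss·𝟙)/m_ss`, coordinate `i`. -/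
def xhatSS (d s : ℕ) (ε : ℝ) (A : Finset (Fin d)) (i : Fin d) : ℝ :=
  ((if i ∈ A then (1 : ℝ) else 0) - bss d s ε) / mss d s ε

/-- Expectation of `f(M/N)` for `M ~ Binomial(N, μ)`. -/
def binomExp (N : ℕ) (μ : ℝ) (f : ℝ → ℝ) : ℝ :=
  ∑ M ∈ Finset.range (N + 1),
    (N.choose M : ℝ) * μ ^ M * (1 - μ) ^ (N - M) * f ((M : ℝ) / (N : ℝ))

/-- The in-cap selection probability of MRC given in-cap fraction `θ`. -/
def hMrc (ε θ : ℝ) : ℝ := Real.exp ε * θ / (Real.exp ε * θ + (1 - θ))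

/-- MRC-simulating-Subset-Selection offset `b_mrc`. -/
def bMrcSS (d s N : ℕ) (ε : ℝ) : ℝ :=
  (1 / ((d : ℝ) - 1)) * binomExp N ((s : ℝ) / (d : ℝ)) (fun θ => (s : ℝ) - hMrc ε θ)

/-- MRC-simulating-Subset-Selection scaling factor `m_mrc`. -/
def mMrcSS (d s N : ℕ) (ε : ℝ) : ℝ :=
  binomExp N ((s : ℝ) / (d : ℝ)) (hMrc ε) - bMrcSS d s N ε

/-- The MRC index distribution simulating Subset Selection:
`P(K = k) ∝ e^ε` for in-cap candidates and `∝ 1` for out-cap candidates. -/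
def piMrcSS (d N : ℕ) (ε : ℝ) (j : Fin d) (zs : Fin N → Finset (Fin d)) (k : Fin N) : ℝ :=
  (if j ∈ zs k then Real.exp ε else 1) /
    ∑ k' : Fin N, (if j ∈ zs k' then Real.exp ε else 1)

/-- Marginal output distribution of MRC simulating Subset Selection over
i.i.d. uniform candidates and the selected index. -/
def qMrcOut (d s N : ℕ) (ε : ℝ) (j : Fin d) (A : Finset (Fin d)) : ℝ :=
  ∑ zs ∈ Fintype.piFinset (fun _ : Fin N => zset d s),
    (1 / ((zset d s).card : ℝ)) ^ N *
      ∑ k : Fin N, if zs k = A then piMrcSS d N ε j zs k else 0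

/-- The debiased MRC estimator `x̂^mrc = (Z_K − b_mrc·𝟙)/m_mrc`, coordinate `i`. -/
def xhatMrc (d s N : ℕ) (ε : ℝ) (A : Finset (Fin d)) (i : Fin d) : ℝ :=
  ((if i ∈ A then (1 : ℝ) else 0) - bMrcSS d s N ε) / mMrcSS d s N ε

/-- The MMRC index distribution simulating Subset Selection (with `μ = s/d` and
`a = e^ε·μ + (1−μ)`). -/
def piMmrcSS (d s N : ℕ) (ε : ℝ) (j : Fin d) (zs : Fin N → Finset (Fin d)) (k : Fin N) : ℝ :=
  let θ : ℝ := ((Finset.univ.filter fun i : Fin N => j ∈ zs i).card : ℝ) / (N : ℝ)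
  let μ : ℝ := (s : ℝ) / (d : ℝ)
  let a : ℝ := Real.exp ε * μ + (1 - μ)
  if θ < μ then
    (if j ∈ zs k then Real.exp ε / ((N : ℝ) * a)
     else (1 - θ * Real.exp ε / a) / ((N : ℝ) * (1 - θ)))
  else if μ < θ then
    (if j ∈ zs k then (1 - (1 - θ) / a) / ((N : ℝ) * θ) else 1 / ((N : ℝ) * a))
  else
    (if j ∈ zs k then Real.exp ε / ((N : ℝ) * (Real.exp ε * θ + (1 - θ)))
     else 1 / ((N : ℝ) * (Real.exp ε * θ + (1 - θ))))

/-- `g(θ) = (e^ε θ/a)·1{θ≤μ} + ((e^ε μ + θ − μ)/a)·1{θ>μ}`. -/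
def gMmrc (ε μ θ : ℝ) : ℝ :=
  if θ ≤ μ then Real.exp ε * θ / (Real.exp ε * μ + (1 - μ))
  else (Real.exp ε * μ + θ - μ) / (Real.exp ε * μ + (1 - μ))

/-- `E[g(θ)]` over `N·θ ~ Binomial(N, s/d)`. -/
def egMmrc (d s N : ℕ) (ε : ℝ) : ℝ :=
  binomExp N ((s : ℝ) / (d : ℝ)) (gMmrc ε ((s : ℝ) / (d : ℝ)))

/-- MMRC-simulating-Subset-Selection scaling factor `m_mmrc`. -/
def mMmrcSS (d s N : ℕ) (ε : ℝ) : ℝ :=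
  ((d : ℝ) / ((d : ℝ) - 1)) * egMmrc d s N ε - (s : ℝ) / ((d : ℝ) - 1)

/-- MMRC-simulating-Subset-Selection offset `b_mmrc`. -/
def bMmrcSS (d s N : ℕ) (ε : ℝ) : ℝ :=
  (1 / ((d : ℝ) - 1)) * ((s : ℝ) - egMmrc d s N ε)

/-- Marginal output distribution of MMRC simulating Subset Selection over
i.i.d. uniform candidates and the selected index. -/
def qMmrcOut (d s N : ℕ) (ε : ℝ) (j : Fin d) (A : Finset (Fin d)) : ℝ :=
  ∑ zs ∈ Fintype.piFinset (fun _ : Fin N => zset d s),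
    (1 / ((zset d s).card : ℝ)) ^ N *
      ∑ k : Fin N, if zs k = A then piMmrcSS d s N ε j zs k else 0

/-- The debiased MMRC estimator `x̂^mmrc = (Z_K − b_mmrc·𝟙)/m_mmrc`, coordinate `i`. -/
def xhatMmrc (d s N : ℕ) (ε : ℝ) (A : Finset (Fin d)) (i : Fin d) : ℝ :=
  ((if i ∈ A then (1 : ℝ) else 0) - bMmrcSS d s N ε) / mMmrcSS d s N ε

/-- Per-user expected squared error of Subset Selection on one-hot input `e_j`. -/
def errSSone (d s : ℕ) (ε : ℝ) (j : Fin d) : ℝ :=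
  ∑ A ∈ zset d s, qss d s ε j A *
    ∑ i : Fin d, (xhatSS d s ε A i - (if i = j then (1 : ℝ) else 0)) ^ 2

/-- Per-user expected squared error of MRC simulating Subset Selection on input `e_j`. -/
def errMrcOne (d s N : ℕ) (ε : ℝ) (j : Fin d) : ℝ :=
  ∑ A ∈ zset d s, qMrcOut d s N ε j A *
    ∑ i : Fin d, (xhatMrc d s N ε A i - (if i = j then (1 : ℝ) else 0)) ^ 2

/-- Per-user expected squared error of MMRC simulating Subset Selection on input `e_j`. -/
def errMmrcOne (d s N : ℕ) (ε : ℝ) (j : Fin d) : ℝ :=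
  ∑ A ∈ zset d s, qMmrcOut d s N ε j A *
    ∑ i : Fin d, (xhatMmrc d s N ε A i - (if i = j then (1 : ℝ) else 0)) ^ 2

/-- `n`-user frequency-estimation squared error of Subset Selection on inputs
`e_{xs 1}, …, e_{xs n}`. -/
def errSSMech (d s n : ℕ) (ε : ℝ) (xs : Fin n → Fin d) : ℝ :=
  ∑ zt ∈ Fintype.piFinset (fun _ : Fin n => zset d s),
    (∏ i : Fin n, qss d s ε (xs i) (zt i)) *
      ∑ j : Fin d,
        ((1 / (n : ℝ)) * (∑ i : Fin n, xhatSS d s ε (zt i) j) -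
            (1 / (n : ℝ)) * (∑ i : Fin n, if j = xs i then (1 : ℝ) else 0)) ^ 2

/-- `n`-user frequency-estimation squared error of MMRC simulating Subset Selection. -/
def errMmrcMech (d s N n : ℕ) (ε : ℝ) (xs : Fin n → Fin d) : ℝ :=
  ∑ zt ∈ Fintype.piFinset (fun _ : Fin n => zset d s),
    (∏ i : Fin n, qMmrcOut d s N ε (xs i) (zt i)) *
      ∑ j : Fin d,
        ((1 / (n : ℝ)) * (∑ i : Fin n, xhatMmrc d s N ε (zt i) j) -
            (1 / (n : ℝ)) * (∑ i : Fin n, if j = xs i then (1 : ℝ) else 0)) ^ 2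

/-! ### Binomial expectations -/

theorem binomExp_add (N : ℕ) (μ : ℝ) (f g : ℝ → ℝ) :
    binomExp N μ (fun θ => f θ + g θ) = binomExp N μ f + binomExp N μ g := by
  simp only [binomExp, mul_add, Finset.sum_add_distrib]

theorem binomExp_const_mul (N : ℕ) (μ c : ℝ) (f : ℝ → ℝ) :
    binomExp N μ (fun θ => c * f θ) = c * binomExp N μ f := by
  simp only [binomExp, Finset.mul_sum]
  exact Finset.sum_congr rfl fun _ _ => by ring

theorem binomExp_mono {N : ℕ} {μ : ℝ} (h0 : 0 ≤ μ) (h1 : μ ≤ 1) {f g : ℝ → ℝ}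
    (h : ∀ θ, f θ ≤ g θ) : binomExp N μ f ≤ binomExp N μ g := by
  have : 0 ≤ 1 - μ := by linarith
  exact Finset.sum_le_sum fun M _ => mul_le_mul_of_nonneg_left (h _) (by positivity)

theorem binomExp_const (N : ℕ) (μ c : ℝ) : binomExp N μ (fun _ => c) = c := by
  have h := add_pow μ (1 - μ) N
  rw [show μ + (1 - μ) = 1 by ring, one_pow] at h
  rw [binomExp, ← Finset.sum_mul]
  rw [Finset.sum_congr rfl fun M _ => (by ring : (N.choose M : ℝ) * μ ^ M * (1 - μ) ^ (N - M)
    = μ ^ M * (1 - μ) ^ (N - M) * (N.choose M : ℝ)), ← h, one_mul]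

theorem binomExp_sub_mean {N : ℕ} (hN : 0 < N) (μ : ℝ) :
    binomExp N μ (fun θ => θ - μ) = 0 := by
  have h := congrArg (Polynomial.eval μ) (bernsteinPolynomial.sum_smul ℝ N)
  simp only [bernsteinPolynomial, Polynomial.eval_finsetSum] at h
  simp at h
  have hN' : (N : ℝ) ≠ 0 := by positivity
  have h1 := binomExp_const N μ (-μ)
  have h2 : binomExp N μ (fun θ => θ) = μ := by
    have : (N : ℝ) * binomExp N μ (fun θ => θ) = N * μ := by
      rw [← h, binomExp, Finset.mul_sum]
      refine Finset.sum_congr rfl fun M _ => ?_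
      field_simp
    exact mul_left_cancel₀ hN' this
  simp only [sub_eq_add_neg, binomExp_add, h1, h2, add_neg_cancel]

theorem binomExp_variance {N : ℕ} (hN : 0 < N) (μ : ℝ) :
    binomExp N μ (fun θ => (θ - μ) ^ 2) = μ * (1 - μ) / N := by
  have h := congrArg (Polynomial.eval μ) (bernsteinPolynomial.variance ℝ N)
  simp only [bernsteinPolynomial, Polynomial.eval_finsetSum] at h
  simp at h
  have hN' : (N : ℝ) ≠ 0 := by positivity
  rw [eq_div_iff hN']
  have : (N : ℝ) * (binomExp N μ (fun θ => (θ - μ) ^ 2) * N) = N * (μ * (1 - μ)) := by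
    rw [← mul_assoc (N : ℝ) μ, ← h, binomExp, Finset.sum_mul, Finset.mul_sum]
    refine Finset.sum_congr rfl fun M _ => ?_
    field_simp
    ring
  exact mul_left_cancel₀ hN' this

/-! ### Counting in the output alphabet -/

theorem filter_notMem_zset {d : ℕ} (s : ℕ) (j : Fin d) :
    (zset d s).filter (fun A => j ∉ A) = Finset.powersetCard s (Finset.univ.erase j) := by
  ext A
  simp [zset, Finset.mem_powersetCard, Finset.subset_erase, and_comm]

theorem card_zset_notMem {d : ℕ} (s : ℕ) (j : Fin d) :
    ((zset d s).filter (fun A => j ∉ A)).card = (d - 1).choose s := by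
  rw [filter_notMem_zset, Finset.card_powersetCard, Finset.card_erase_of_mem (Finset.mem_univ j),
    Finset.card_univ, Fintype.card_fin]

theorem card_zset (d s : ℕ) : (zset d s).card = d.choose s := by
  simp [zset]

theorem card_zset_mem {d s : ℕ} (hs : 0 < s) (j : Fin d) :
    ((zset d s).filter (fun A => j ∈ A)).card = (d - 1).choose (s - 1) := by
  have h := Finset.card_filter_add_card_filter_not (s := zset d s) (fun A => j ∈ A)
  rw [card_zset_notMem, card_zset] at h
  have := Nat.choose_eq_choose_pred_add (Fin.pos j) hs
  omega

theorem mul_choose_pred (d s : ℕ) (hd : 0 < d) (hs : 0 < s) :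
    (d : ℝ) * ((d - 1).choose (s - 1) : ℝ) = s * (d.choose s : ℝ) := by
  obtain ⟨d, rfl⟩ := Nat.exists_eq_succ_of_ne_zero hd.ne'
  obtain ⟨s, rfl⟩ := Nat.exists_eq_succ_of_ne_zero hs.ne'
  have := Nat.add_one_mul_choose_eq d s
  simp only [Nat.succ_eq_add_one, Nat.add_sub_cancel]
  rw [mul_comm ((s + 1 : ℕ) : ℝ)]
  exact_mod_cast this

theorem choose_pred_add (d s : ℕ) (hd : 0 < d) (hs : 0 < s) :
    ((d - 1).choose (s - 1) : ℝ) + ((d - 1).choose s : ℝ) = (d.choose s : ℝ) := by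
  exact_mod_cast (Nat.choose_eq_choose_pred_add hd hs).symm

theorem sum_mem_indicator_zset {d s : ℕ} {A : Finset (Fin d)} (hA : A ∈ zset d s) :
    ∑ i : Fin d, (if i ∈ A then (1 : ℝ) else 0) = s := by
  rw [Finset.sum_boole, ← (Finset.mem_powersetCard.1 hA).2]
  simp

theorem map_mem_zset {d s : ℕ} (σ : Equiv.Perm (Fin d)) (A : Finset (Fin d)) :
    A.map σ.toEmbedding ∈ zset d s ↔ A ∈ zset d s := by
  simp [zset, Finset.mem_powersetCard]

/-! ### Mean squared error of an unbiased mechanism -/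

theorem sum_mem_eq_of_perm_invariant {d : ℕ} (s : ℕ) {j i i' : Fin d} (hi : i ≠ j) (hi' : i' ≠ j)
    (q : Finset (Fin d) → ℝ)
    (hq : ∀ σ : Equiv.Perm (Fin d), σ j = j → ∀ A, q (A.map σ.toEmbedding) = q A) :
    ∑ A ∈ zset d s, q A * (if i ∈ A then (1 : ℝ) else 0) =
      ∑ A ∈ zset d s, q A * (if i' ∈ A then (1 : ℝ) else 0) := by
  refine Finset.sum_equiv (Equiv.swap i i').finsetCongr (fun A => ?_) fun A _ => ?_
  · exact (map_mem_zset _ A).symm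
  · rw [Equiv.finsetCongr_apply, hq _ (Equiv.swap_apply_of_ne_of_ne hi.symm hi'.symm)]
    congr 1
    simp [Finset.mem_map_equiv]

theorem sum_mem_eq_of_ne {d s : ℕ} (hd : 2 ≤ d) {j : Fin d} {p : ℝ} {q : Finset (Fin d) → ℝ}
    (hq : ∀ σ : Equiv.Perm (Fin d), σ j = j → ∀ A, q (A.map σ.toEmbedding) = q A)
    (hsum : ∑ A ∈ zset d s, q A = 1)
    (hp : ∑ A ∈ zset d s, q A * (if j ∈ A then (1 : ℝ) else 0) = p) {i : Fin d} (hi : i ≠ j) :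
    ∑ A ∈ zset d s, q A * (if i ∈ A then (1 : ℝ) else 0) = (s - p) / (d - 1) := by
  have htot : ∑ i : Fin d, ∑ A ∈ zset d s, q A * (if i ∈ A then (1 : ℝ) else 0) = s := by
    rw [Finset.sum_comm]
    simp_rw [← Finset.mul_sum]
    rw [Finset.sum_congr rfl fun A hA => by rw [sum_mem_indicator_zset hA], ← Finset.sum_mul, hsum,
      one_mul]
  rw [← Finset.add_sum_erase _ _ (Finset.mem_univ j), hp,
    Finset.sum_congr rfl fun i' hi' =>
      sum_mem_eq_of_perm_invariant s (Finset.ne_of_mem_erase hi') hi q hq,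
    Finset.sum_const, Finset.card_erase_of_mem (Finset.mem_univ j), Finset.card_univ,
    Fintype.card_fin, nsmul_eq_mul, Nat.cast_sub (by omega), Nat.cast_one] at htot
  have : (2 : ℝ) ≤ d := by exact_mod_cast hd
  rw [eq_div_iff (by linarith)]
  linarith

theorem sum_pi_prod_mul_sq_sum {ι α : Type*} [Fintype ι] [DecidableEq ι] (t : Finset α) (q Y : ι → α → ℝ)
    (hq : ∀ i, ∑ A ∈ t, q i A = 1) (hY : ∀ i, ∑ A ∈ t, q i A * Y i A = 0) :
    ∑ z ∈ Fintype.piFinset (fun _ : ι => t), (∏ i, q i (z i)) * (∑ i, Y i (z i)) ^ 2 =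
      ∑ i, ∑ A ∈ t, q i A * Y i A ^ 2 := by
  have key : ∀ i i', ∑ z ∈ Fintype.piFinset (fun _ : ι => t),
      (∏ k, q k (z k)) * (Y i (z i) * Y i' (z i')) =
      if i = i' then ∑ A ∈ t, q i A * Y i A ^ 2 else 0 := by
    intro i i'
    have h1 : ∀ z : ι → α, (∏ k, q k (z k)) * (Y i (z i) * Y i' (z i')) =
        ∏ k, (q k (z k) * ((if k = i then Y k (z k) else 1) *
          (if k = i' then Y k (z k) else 1))) := by
      intro z
      simp only [Finset.prod_mul_distrib, Finset.prod_ite_eq', Finset.mem_univ, if_true]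
    simp_rw [h1]
    rw [← Finset.prod_univ_sum (fun _ => t) (fun k A => q k A * ((if k = i then Y k A else 1) *
          (if k = i' then Y k A else 1)))]
    split_ifs with h
    · subst h
      rw [Finset.prod_eq_single i]
      · simp [sq]
      · intro k _ hk
        simp [hk, hq]
      · simp
    · refine Finset.prod_eq_zero (Finset.mem_univ i) ?_
      simp [h, hY]
  simp_rw [sq (∑ i, _), Finset.sum_mul_sum, Finset.mul_sum]
  rw [Finset.sum_comm]
  refine Finset.sum_congr rfl fun i _ => ?_
  rw [Finset.sum_comm]
  simp_rw [key]
  simp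

theorem mean_sq_error_eq {d s n : ℕ} (hd : 2 ≤ d) (hn : 0 < n) {p m b : ℝ}
    {q : Fin d → Finset (Fin d) → ℝ}
    (hq : ∀ j, ∀ σ : Equiv.Perm (Fin d), σ j = j → ∀ A, q j (A.map σ.toEmbedding) = q j A)
    (hsum : ∀ j, ∑ A ∈ zset d s, q j A = 1)
    (hp : ∀ j, ∑ A ∈ zset d s, q j A * (if j ∈ A then (1 : ℝ) else 0) = p)
    (hb : b = (s - p) / (d - 1)) (hm : m = p - b) (hm0 : m ≠ 0) (xs : Fin n → Fin d) :
    ∑ zt ∈ Fintype.piFinset (fun _ : Fin n => zset d s), (∏ i, q (xs i) (zt i)) *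
      ∑ j : Fin d, ((1 / (n : ℝ)) * (∑ i : Fin n, ((if j ∈ zt i then (1 : ℝ) else 0) - b) / m) -
            (1 / (n : ℝ)) * (∑ i : Fin n, if j = xs i then (1 : ℝ) else 0)) ^ 2 =
      (p * (1 - p) + (d - 1) * (b * (1 - b))) / m ^ 2 / n := by
  have hmean : ∀ x j, ∑ A ∈ zset d s, q x A * (if j ∈ A then (1 : ℝ) else 0) =
      if j = x then p else b := by
    intro x j
    split_ifs with h
    · rw [h, hp]
    · rw [sum_mem_eq_of_ne hd (hq x) (hsum x) (hp x) h, hb]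
  set Y : Fin d → Fin d → Finset (Fin d) → ℝ := fun x j A =>
    ((if j ∈ A then (1 : ℝ) else 0) - b) / m - if j = x then 1 else 0 with hYdef
  have hY : ∀ x j, ∑ A ∈ zset d s, q x A * Y x j A = 0 := by
    intro x j
    have h1 : ∀ A, q x A * Y x j A = m⁻¹ * (q x A * (if j ∈ A then (1 : ℝ) else 0)) -
        (b / m + if j = x then 1 else 0) * q x A := fun A => by simp only [hYdef]; ring
    simp_rw [h1, Finset.sum_sub_distrib, ← Finset.mul_sum, hmean, hsum]
    split_ifs
    · field_simp
      linarith
    · field_simp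
      ring
  have hY2 : ∀ x j, ∑ A ∈ zset d s, q x A * Y x j A ^ 2 =
      (if j = x then p * (1 - p) else b * (1 - b)) / m ^ 2 := by
    intro x j
    have h1 : ∀ A, q x A * Y x j A ^ 2 =
        (1 - 2 * (if j = x then p else b)) / m ^ 2 * (q x A * (if j ∈ A then (1 : ℝ) else 0)) +
        (if j = x then p else b) ^ 2 / m ^ 2 * q x A := by
      intro A
      have : Y x j A = ((if j ∈ A then (1 : ℝ) else 0) - if j = x then p else b) / m := by
        simp only [hYdef]
        split_ifs <;> field_simp <;> linarith
      rw [this]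
      split_ifs <;> field_simp <;> ring
    simp_rw [h1, Finset.sum_add_distrib, ← Finset.mul_sum, hmean, hsum]
    split_ifs <;> field_simp <;> ring
  have hn' : (n : ℝ) ≠ 0 := by positivity
  calc _ = ∑ j, (1 / (n : ℝ)) ^ 2 * ∑ zt ∈ Fintype.piFinset (fun _ : Fin n => zset d s),
        (∏ i, q (xs i) (zt i)) * (∑ i, Y (xs i) j (zt i)) ^ 2 := by
        simp_rw [Finset.mul_sum]
        rw [Finset.sum_comm]
        refine Finset.sum_congr rfl fun j _ => Finset.sum_congr rfl fun zt _ => ?_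
        simp only [hYdef, Finset.sum_sub_distrib, ← Finset.mul_sum]
        ring
    _ = ∑ j, (1 / (n : ℝ)) ^ 2 * ∑ i : Fin n,
        (if j = xs i then p * (1 - p) else b * (1 - b)) / m ^ 2 := by
        refine Finset.sum_congr rfl fun j _ => ?_
        rw [sum_pi_prod_mul_sq_sum (zset d s) (fun i => q (xs i)) (fun i => Y (xs i) j)
          (fun i => hsum _) (fun i => hY _ _)]
        simp_rw [hY2]
    _ = (1 / (n : ℝ)) ^ 2 * ∑ i : Fin n, (p * (1 - p) + (d - 1) * (b * (1 - b))) / m ^ 2 := by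
        rw [← Finset.mul_sum, Finset.sum_comm]
        congr 1
        refine Finset.sum_congr rfl fun i _ => ?_
        rw [← Finset.sum_div, ← Finset.add_sum_erase _ _ (Finset.mem_univ (xs i)), if_pos rfl,
          Finset.sum_congr rfl fun j hj => if_neg (Finset.ne_of_mem_erase hj), Finset.sum_const,
          Finset.card_erase_of_mem (Finset.mem_univ _), Finset.card_univ, Fintype.card_fin,
          nsmul_eq_mul, Nat.cast_sub (by omega), Nat.cast_one]
    _ = _ := by
        rw [Finset.sum_const, Finset.card_univ, Fintype.card_fin, nsmul_eq_mul]
        field_simp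

/-! ### Subset Selection -/

theorem qss_map {d : ℕ} (s : ℕ) (ε : ℝ) {j : Fin d} {σ : Equiv.Perm (Fin d)} (hσ : σ j = j)
    (A : Finset (Fin d)) : qss d s ε j (A.map σ.toEmbedding) = qss d s ε j A := by
  have : σ.symm j = j := by rw [Equiv.symm_apply_eq, hσ]
  simp [qss, Finset.mem_map_equiv, this]

theorem qssC_pos {d s : ℕ} (ε : ℝ) (hs : 0 < s) (hsd : s < d) : 0 < qssC d s ε := by
  have h1 : 0 < (d - 1).choose (s - 1) := Nat.choose_pos (by omega)
  have : (0 : ℝ) < ((d - 1).choose (s - 1) : ℝ) := by exact_mod_cast h1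
  rw [qssC]
  positivity

theorem sum_qss {d s : ℕ} (ε : ℝ) (hs : 0 < s) (hsd : s < d) (j : Fin d) :
    ∑ A ∈ zset d s, qss d s ε j A = 1 := by
  have h := qssC_pos ε hs hsd
  simp only [qss]
  rw [Finset.sum_ite, Finset.sum_const, Finset.sum_const, card_zset_mem hs, card_zset_notMem,
    nsmul_eq_mul, nsmul_eq_mul, ← mul_div_assoc, ← mul_div_assoc, ← add_div, mul_one]
  exact div_self h.ne'

theorem sum_qss_mem {d s : ℕ} (ε : ℝ) (hs : 0 < s) (hsd : s < d) (j : Fin d) :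
    ∑ A ∈ zset d s, qss d s ε j A * (if j ∈ A then (1 : ℝ) else 0) =
      s * Real.exp ε / (s * Real.exp ε + (d - s)) := by
  have h := qssC_pos ε hs hsd
  have h1 : ∀ A, qss d s ε j A * (if j ∈ A then (1 : ℝ) else 0) =
      if j ∈ A then Real.exp ε / qssC d s ε else 0 := by
    intro A
    simp only [qss]
    split_ifs <;> simp
  simp_rw [h1]
  rw [← Finset.sum_filter, Finset.sum_const, card_zset_mem hs, nsmul_eq_mul]
  have h2 := mul_choose_pred d s (by omega) hs
  have h3 := choose_pred_add d s (by omega) hs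
  have h4 : (s : ℝ) < d := by exact_mod_cast hsd
  have h5 := Real.exp_pos ε
  have h6 : 0 < (s : ℝ) * Real.exp ε + (d - s) := by
    have : (0 : ℝ) < d - s := by linarith
    positivity
  rw [← mul_div_assoc, div_eq_div_iff h.ne' h6.ne', qssC]
  linear_combination Real.exp ε * (h2 - s * h3)

/-! ### The modified minimal random coding mechanism -/

theorem sum_ite_mem_const {d N : ℕ} (j : Fin d) (zs : Fin N → Finset (Fin d)) (α β : ℝ) :
    ∑ k, (if j ∈ zs k then α else β) =
      ((Finset.univ.filter fun i : Fin N => j ∈ zs i).card : ℝ) * α +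
        (N - ((Finset.univ.filter fun i : Fin N => j ∈ zs i).card : ℝ)) * β := by
  have h := Finset.card_filter_add_card_filter_not (s := Finset.univ) (fun i : Fin N => j ∈ zs i)
  rw [Finset.card_univ, Fintype.card_fin] at h
  rw [Finset.sum_ite, Finset.sum_const, Finset.sum_const, nsmul_eq_mul, nsmul_eq_mul]
  have h' := congrArg (Nat.cast (R := ℝ)) h
  push_cast at h'
  rw [← h', add_sub_cancel_left]

theorem sum_piMmrcSS {d s N : ℕ} (ε : ℝ) (hsd : s < d) (hN : 0 < N) (j : Fin d)
    (zs : Fin N → Finset (Fin d)) : ∑ k, piMmrcSS d s N ε j zs k = 1 := by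
  have hN' : (0 : ℝ) < N := by exact_mod_cast hN
  have hd : (0 : ℝ) < d := by exact_mod_cast (by omega : 0 < d)
  have hμ0 : (0 : ℝ) ≤ s / d := by positivity
  have hμ1 : (s : ℝ) / d < 1 := by
    rw [div_lt_one hd]
    exact_mod_cast hsd
  have hE := Real.exp_pos ε
  have hc := sum_ite_mem_const j zs
  simp only [piMmrcSS]
  generalize ((Finset.univ.filter fun i : Fin N => j ∈ zs i).card : ℝ) = c at *
  obtain ⟨θ, rfl⟩ : ∃ θ, c = N * θ := ⟨c / N, by field_simp⟩
  rw [mul_div_cancel_left₀ _ hN'.ne'] at *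
  generalize (s : ℝ) / d = μ at *
  have ha : 0 < Real.exp ε * μ + (1 - μ) := by
    have : 0 < 1 - μ := by linarith
    positivity
  split_ifs with h1 h2
  · have : (1 - θ) ≠ 0 := by linarith
    rw [hc]
    field_simp
    ring
  · have : θ ≠ 0 := by linarith
    rw [hc]
    field_simp
    ring
  · obtain rfl : θ = μ := by linarith
    rw [hc, mul_one_div, ← mul_div_assoc, ← add_div, div_eq_one_iff_eq (by positivity)]
    ring

theorem sum_piMmrcSS_mem {d s N : ℕ} (ε : ℝ) (hsd : s < d) (hN : 0 < N) (j : Fin d)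
    (zs : Fin N → Finset (Fin d)) :
    ∑ k, piMmrcSS d s N ε j zs k * (if j ∈ zs k then (1 : ℝ) else 0) =
      gMmrc ε (s / d) (((Finset.univ.filter fun i : Fin N => j ∈ zs i).card : ℝ) / N) := by
  have hN' : (0 : ℝ) < N := by exact_mod_cast hN
  have hd : (0 : ℝ) < d := by exact_mod_cast (by omega : 0 < d)
  have hμ0 : (0 : ℝ) ≤ s / d := by positivity
  have hμ1 : (s : ℝ) / d < 1 := by
    rw [div_lt_one hd]
    exact_mod_cast hsd
  have hE := Real.exp_pos ε
  have hc := sum_ite_mem_const j zs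
  simp only [piMmrcSS, gMmrc]
  generalize ((Finset.univ.filter fun i : Fin N => j ∈ zs i).card : ℝ) = c at *
  obtain ⟨θ, rfl⟩ : ∃ θ, c = N * θ := ⟨c / N, by field_simp⟩
  rw [mul_div_cancel_left₀ _ hN'.ne'] at *
  generalize (s : ℝ) / d = μ at *
  have ha : 0 < Real.exp ε * μ + (1 - μ) := by
    have : 0 < 1 - μ := by linarith
    positivity
  rcases lt_trichotomy θ μ with h | h | h
  · simp only [h, h.le, if_true]
    rw [Finset.sum_congr rfl fun k _ => (by split_ifs <;> simp :
      _ = if j ∈ zs k then Real.exp ε / (N * (Real.exp ε * μ + (1 - μ))) else 0), hc]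
    field_simp
    ring
  · subst h
    simp only [lt_irrefl, le_refl, if_true, if_false]
    rw [Finset.sum_congr rfl fun k _ => (by split_ifs <;> simp :
      _ = if j ∈ zs k then Real.exp ε / (N * (Real.exp ε * θ + (1 - θ))) else 0), hc]
    field_simp
    ring
  · have hθ : θ ≠ 0 := by linarith
    simp only [h, h.not_gt, h.not_ge, if_true, if_false]
    rw [Finset.sum_congr rfl fun k _ => (by split_ifs <;> simp :
      _ = if j ∈ zs k then (1 - (1 - θ) / (Real.exp ε * μ + (1 - μ))) / (N * θ) else 0), hc]
    field_simp
    ring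

theorem piMmrcSS_map {d : ℕ} (s N : ℕ) (ε : ℝ) {j : Fin d} {σ : Equiv.Perm (Fin d)}
    (hσ : σ j = j) (zs : Fin N → Finset (Fin d)) (k : Fin N) :
    piMmrcSS d s N ε j (fun k => (zs k).map σ.toEmbedding) k = piMmrcSS d s N ε j zs k := by
  have : σ.symm j = j := by rw [Equiv.symm_apply_eq, hσ]
  simp only [piMmrcSS, Finset.mem_map_equiv, this]

theorem qMmrcOut_map {d : ℕ} (s N : ℕ) (ε : ℝ) {j : Fin d} {σ : Equiv.Perm (Fin d)}
    (hσ : σ j = j) (A : Finset (Fin d)) :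
    qMmrcOut d s N ε j (A.map σ.toEmbedding) = qMmrcOut d s N ε j A := by
  symm
  refine Finset.sum_equiv (Equiv.piCongrRight fun _ : Fin N => σ.finsetCongr) (fun zs => ?_)
    fun zs _ => ?_
  · simp [Fintype.mem_piFinset, map_mem_zset]
  · congr 1
    refine Finset.sum_congr rfl fun k _ => ?_
    have h := piMmrcSS_map s N ε hσ zs k
    simp only [Equiv.piCongrRight_apply, Pi.map_apply, Equiv.finsetCongr_apply, Finset.map_inj]
    exact if_congr Iff.rfl h.symm rfl

theorem sum_qMmrcOut_mul (d s N : ℕ) (ε : ℝ) (j : Fin d) (F : Finset (Fin d) → ℝ) :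
    ∑ A ∈ zset d s, qMmrcOut d s N ε j A * F A =
      ∑ zs ∈ Fintype.piFinset (fun _ : Fin N => zset d s),
        (1 / ((zset d s).card : ℝ)) ^ N * ∑ k, piMmrcSS d s N ε j zs k * F (zs k) := by
  simp only [qMmrcOut, Finset.sum_mul]
  rw [Finset.sum_comm]
  refine Finset.sum_congr rfl fun zs hzs => ?_
  simp only [mul_assoc]
  rw [← Finset.mul_sum]
  congr 1
  simp only [Finset.sum_mul]
  rw [Finset.sum_comm]
  refine Finset.sum_congr rfl fun k _ => ?_
  simp only [ite_mul, zero_mul]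
  rw [Finset.sum_ite_eq, if_pos (Fintype.mem_piFinset.1 hzs k)]

theorem sum_qMmrcOut {d s N : ℕ} (ε : ℝ) (hsd : s < d) (hN : 0 < N) (j : Fin d) :
    ∑ A ∈ zset d s, qMmrcOut d s N ε j A = 1 := by
  have h := sum_qMmrcOut_mul d s N ε j (fun _ => 1)
  simp only [mul_one, sum_piMmrcSS ε hsd hN] at h
  have hc : (0 : ℝ) < (zset d s).card := by
    rw [card_zset]
    exact_mod_cast Nat.choose_pos hsd.le
  rw [h, Finset.sum_const, Fintype.card_piFinset, Finset.prod_const, Finset.card_univ,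
    Fintype.card_fin, nsmul_eq_mul]
  push_cast
  rw [← mul_pow, mul_one_div_cancel hc.ne', one_pow]

theorem card_piFinset_zset_filter {d s : ℕ} (N : ℕ) (hs : 0 < s) (j : Fin d)
    (T : Finset (Fin N)) :
    ((Fintype.piFinset (fun _ : Fin N => zset d s)).filter
      (fun zs => (Finset.univ.filter fun i => j ∈ zs i) = T)).card =
      (d - 1).choose (s - 1) ^ T.card * (d - 1).choose s ^ (N - T.card) := by
  have : (Fintype.piFinset (fun _ : Fin N => zset d s)).filter
      (fun zs => (Finset.univ.filter fun i => j ∈ zs i) = T) =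
      Fintype.piFinset (fun i => if i ∈ T then (zset d s).filter (fun A => j ∈ A)
        else (zset d s).filter (fun A => j ∉ A)) := by
    ext zs
    simp only [Finset.mem_filter, Fintype.mem_piFinset, Finset.ext_iff, Finset.mem_univ, true_and,
      ← forall_and]
    refine forall_congr' fun i => ?_
    by_cases hi : i ∈ T <;> simp [hi]
  rw [this, Fintype.card_piFinset]
  simp only [apply_ite Finset.card, card_zset_mem hs, card_zset_notMem]
  rw [Finset.prod_ite, Finset.prod_const, Finset.prod_const]
  have h := Finset.card_filter_add_card_filter_not (s := Finset.univ) (fun i : Fin N => i ∈ T)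
  rw [Finset.card_univ, Fintype.card_fin] at h
  rw [Finset.filter_univ_mem] at *
  congr 2
  omega

theorem sum_piFinset_zset_eq_binomExp {d s : ℕ} (N : ℕ) (hs : 0 < s) (hsd : s < d) (j : Fin d)
    (f : ℝ → ℝ) :
    ∑ zs ∈ Fintype.piFinset (fun _ : Fin N => zset d s), (1 / ((zset d s).card : ℝ)) ^ N *
      f (((Finset.univ.filter fun i : Fin N => j ∈ zs i).card : ℝ) / N) =
      binomExp N (s / d) f := by
  have hc : (0 : ℝ) < d.choose s := by exact_mod_cast Nat.choose_pos hsd.le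
  have hd : (0 : ℝ) < d := by exact_mod_cast (by omega : 0 < d)
  have h2 := mul_choose_pred d s (by omega) hs
  have h3 := choose_pred_add d s (by omega) hs
  have hin : ((d - 1).choose (s - 1) : ℝ) = d.choose s * (s / d) := by
    field_simp
    linarith
  have hout : ((d - 1).choose s : ℝ) = d.choose s * (1 - s / d) := by
    rw [mul_sub, ← hin]
    linarith
  refine (Finset.sum_fiberwise' (Fintype.piFinset fun _ : Fin N => zset d s) (fun zs => Finset.univ.filter fun i : Fin N => j ∈ zs i)
    (fun T => (1 / ((zset d s).card : ℝ)) ^ N * f ((T.card : ℝ) / N))).symm.trans ?_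
  simp only [Finset.sum_const, card_piFinset_zset_filter N hs j]
  rw [← Finset.powerset_univ, Finset.sum_powerset_apply_card (fun M =>
    ((d - 1).choose (s - 1) ^ M * (d - 1).choose s ^ (N - M)) •
      ((1 / ((zset d s).card : ℝ)) ^ N * f ((M : ℝ) / N))), Finset.card_univ, Fintype.card_fin,
    binomExp]
  refine Finset.sum_congr rfl fun M hM => ?_
  have hM' : M + (N - M) = N := by
    have := Finset.mem_range.1 hM
    omega
  simp only [nsmul_eq_mul, card_zset]
  push_cast
  rw [hin, hout, mul_pow, mul_pow]
  have : ((d.choose s : ℝ)) ^ M * (d.choose s : ℝ) ^ (N - M) * (1 / (d.choose s : ℝ)) ^ N = 1 := by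
    rw [← pow_add, hM', ← mul_pow, mul_one_div_cancel hc.ne', one_pow]
  linear_combination ((N.choose M : ℝ) * (s / d : ℝ) ^ M * (1 - s / d : ℝ) ^ (N - M) *
    f ((M : ℝ) / N)) * this

theorem sum_qMmrcOut_mem {d s N : ℕ} (ε : ℝ) (hs : 0 < s) (hsd : s < d) (hN : 0 < N)
    (j : Fin d) :
    ∑ A ∈ zset d s, qMmrcOut d s N ε j A * (if j ∈ A then (1 : ℝ) else 0) =
      egMmrc d s N ε := by
  rw [sum_qMmrcOut_mul d s N ε j (fun A => if j ∈ A then (1 : ℝ) else 0)]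
  simp only [sum_piMmrcSS_mem ε hsd hN]
  exact sum_piFinset_zset_eq_binomExp N hs hsd j _

/-! ### Comparison of the two mechanisms -/

theorem gMmrc_le {ε μ θ : ℝ} (hε : 0 ≤ ε) (ha : 0 < Real.exp ε * μ + (1 - μ)) :
    gMmrc ε μ θ ≤ Real.exp ε * μ / (Real.exp ε * μ + (1 - μ)) +
      1 / (Real.exp ε * μ + (1 - μ)) * (θ - μ) := by
  have hE : 1 ≤ Real.exp ε := Real.one_le_exp hε
  rw [gMmrc, one_div_mul_eq_div, ← add_div]
  split_ifs
  · gcongr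
    nlinarith
  · gcongr
    linarith

theorem le_gMmrc {ε μ θ v : ℝ} (hε : 0 ≤ ε) (ha : 0 < Real.exp ε * μ + (1 - μ)) (hv : 0 < v) :
    Real.exp ε * μ / (Real.exp ε * μ + (1 - μ)) +
      1 / (Real.exp ε * μ + (1 - μ)) * (θ - μ) -
      (Real.exp ε - 1) / (Real.exp ε * μ + (1 - μ)) *
        ((μ - θ) / 2 + ((θ - μ) ^ 2 / v + v) / 4) ≤ gMmrc ε μ θ := by
  have hE : 0 ≤ Real.exp ε - 1 := by linarith [Real.one_le_exp hε]
  have h1 : 2 * (θ - μ) ≤ (θ - μ) ^ 2 / v + v := by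
    rw [← sub_le_iff_le_add, le_div_iff₀ hv]
    nlinarith [sq_nonneg (θ - μ - v)]
  have h2 : 2 * (μ - θ) ≤ (θ - μ) ^ 2 / v + v := by
    rw [← sub_le_iff_le_add, le_div_iff₀ hv]
    nlinarith [sq_nonneg (θ - μ + v)]
  generalize (θ - μ) ^ 2 / v = w at *
  rw [gMmrc, one_div_mul_eq_div, ← add_div, div_mul_eq_mul_div, ← sub_div]
  split_ifs
  · gcongr
    nlinarith
  · refine div_le_div_of_nonneg_right ?_ ha.le
    nlinarith

theorem egMmrc_le {d s N : ℕ} {ε : ℝ} (hε : 0 ≤ ε) (hsd : s < d) (hN : 0 < N) :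
    egMmrc d s N ε ≤ Real.exp ε * (s / d) / (Real.exp ε * (s / d) + (1 - s / d)) := by
  have hd : (0 : ℝ) < d := by exact_mod_cast (by omega : 0 < d)
  have hμ0 : (0 : ℝ) ≤ s / d := by positivity
  have hμ1 : (s : ℝ) / d < 1 := by
    rw [div_lt_one hd]
    exact_mod_cast hsd
  rw [egMmrc]
  generalize (s : ℝ) / d = μ at *
  have ha : 0 < Real.exp ε * μ + (1 - μ) := by
    have : 0 < 1 - μ := by linarith
    positivity
  refine (binomExp_mono hμ0 hμ1.le fun θ => gMmrc_le hε ha).trans ?_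
  rw [binomExp_add, binomExp_const, binomExp_const_mul, binomExp_sub_mean hN, mul_zero, add_zero]

theorem le_egMmrc {d s N : ℕ} {ε v : ℝ} (hε : 0 ≤ ε) (hsd : s < d) (hN : 0 < N) (hv : 0 < v)
    (hvar : (s / d : ℝ) * (1 - s / d) / N ≤ v ^ 2) :
    Real.exp ε * (s / d) / (Real.exp ε * (s / d) + (1 - s / d)) -
      (Real.exp ε - 1) / (Real.exp ε * (s / d) + (1 - s / d)) * (v / 2) ≤ egMmrc d s N ε := by
  have hd : (0 : ℝ) < d := by exact_mod_cast (by omega : 0 < d)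
  have hμ0 : (0 : ℝ) ≤ s / d := by positivity
  have hμ1 : (s : ℝ) / d < 1 := by
    rw [div_lt_one hd]
    exact_mod_cast hsd
  rw [egMmrc]
  generalize (s : ℝ) / d = μ at *
  have ha : 0 < Real.exp ε * μ + (1 - μ) := by
    have : 0 < 1 - μ := by linarith
    positivity
  have hE : 0 ≤ Real.exp ε - 1 := by linarith [Real.one_le_exp hε]
  refine le_trans ?_ (binomExp_mono hμ0 hμ1.le fun θ => le_gMmrc hε ha hv)
  generalize Real.exp ε * μ + (1 - μ) = a at *
  have h1 : (fun θ => Real.exp ε * μ / a + 1 / a * (θ - μ) -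
      (Real.exp ε - 1) / a * ((μ - θ) / 2 + ((θ - μ) ^ 2 / v + v) / 4)) =
      fun θ => (Real.exp ε * μ / a - (Real.exp ε - 1) / a * (v / 4)) +
        ((1 / a + (Real.exp ε - 1) / a / 2) * (θ - μ) +
          (-((Real.exp ε - 1) / a / v / 4)) * (θ - μ) ^ 2) := by
    funext θ
    ring
  rw [h1, binomExp_add N μ (fun _ => _), binomExp_add N μ (fun θ => _ * (θ - μ)), binomExp_const,
    binomExp_const_mul N μ _ (fun θ => θ - μ), binomExp_const_mul N μ _ (fun θ => (θ - μ) ^ 2),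
    binomExp_sub_mean hN, binomExp_variance hN]
  have h2 : (Real.exp ε - 1) / a / v / 4 * (μ * (1 - μ) / N) ≤
      (Real.exp ε - 1) / a / v / 4 * v ^ 2 := by gcongr
  have h3 : (Real.exp ε - 1) / a / v / 4 * v ^ 2 = (Real.exp ε - 1) / a * (v / 4) := by
    field_simp
  linarith

theorem error_ratio_le {S D δ δ₀ lam y : ℝ} (hS : 0 < S) (hD : 0 < D) (hδ₀ : 0 < δ₀)
    (hlam : 0 < lam) (hy : 1 ≤ y) (hW : D * δ₀ ^ 2 ≤ S * (1 - 1 / (2 * y))) (hle : δ ≤ δ₀)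
    (hge : δ₀ * (1 - lam / (5 * (1 + lam) * y)) ≤ δ) :
    (S - D * δ ^ 2) / (D * δ) ^ 2 ≤ (1 + 4 * lam + 5 * lam ^ 2 + 2 * lam ^ 3) *
      ((S - D * δ₀ ^ 2) / (D * δ₀) ^ 2) := by
  set κ := lam / (5 * (1 + lam) * y) with hκ
  have hy0 : 0 < y := by linarith
  have hκ0 : 0 < κ := by positivity
  have hκ1 : κ ≤ 1 / 5 := by
    rw [hκ, div_le_div_iff₀ (by positivity) (by norm_num)]
    nlinarith
  have hκ2 : κ ≤ lam / (5 * y) := by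
    rw [hκ]
    gcongr
    nlinarith
  have hδ : 4 / 5 * δ₀ ≤ δ := by nlinarith
  have hδ' : 0 < δ := by linarith
  have h1 : δ₀ ^ 2 - δ ^ 2 ≤ 2 * (lam / y) * δ ^ 2 := by
    have e1 : δ₀ ^ 2 - δ ^ 2 ≤ 2 * κ * δ₀ ^ 2 := by nlinarith
    have e2 : lam / (5 * y) = lam / y / 5 := by field_simp
    have e3 : δ₀ ^ 2 ≤ 25 / 16 * δ ^ 2 := by nlinarith
    have e4 : 0 < lam / y := by positivity
    calc δ₀ ^ 2 - δ ^ 2 ≤ 2 * κ * δ₀ ^ 2 := e1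
      _ ≤ 2 * (lam / y / 5) * (25 / 16 * δ ^ 2) := by
        rw [e2] at hκ2
        gcongr
      _ ≤ _ := by nlinarith [mul_pos e4 (pow_pos hδ' 2)]
  set W := S - D * δ₀ ^ 2 with hWd
  have hW' : S / (2 * y) ≤ W := by
    have : S * (1 - 1 / (2 * y)) = S - S / (2 * y) := by ring
    linarith
  have hW0 : 0 < W := lt_of_lt_of_le (by positivity) hW'
  have h2 : S * (δ₀ ^ 2 - δ ^ 2) ≤ 4 * lam * W * δ ^ 2 := by
    calc S * (δ₀ ^ 2 - δ ^ 2) ≤ S * (2 * (lam / y) * δ ^ 2) := by gcongr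
      _ = 4 * lam * (S / (2 * y)) * δ ^ 2 := by field_simp; ring
      _ ≤ _ := by gcongr
  rw [← mul_div_assoc, div_le_div_iff₀ (by positivity) (by positivity)]
  have h3 : (S - D * δ ^ 2) * δ₀ ^ 2 ≤ (1 + 4 * lam) * W * δ ^ 2 := by
    rw [hWd] at h2 ⊢
    linarith
  have h4 : (1 + 4 * lam) * W * δ ^ 2 ≤
      (1 + 4 * lam + 5 * lam ^ 2 + 2 * lam ^ 3) * W * δ ^ 2 := by
    have : 0 < 5 * lam ^ 2 + 2 * lam ^ 3 := by positivity
    refine mul_le_mul_of_nonneg_right (mul_le_mul_of_nonneg_right ?_ hW0.le) (by positivity)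
    linarith
  calc (S - D * δ ^ 2) * (D * δ₀) ^ 2 = D ^ 2 * ((S - D * δ ^ 2) * δ₀ ^ 2) := by ring
    _ ≤ D ^ 2 * ((1 + 4 * lam + 5 * lam ^ 2 + 2 * lam ^ 3) * W * δ ^ 2) :=
      mul_le_mul_of_nonneg_left (h3.trans h4) (by positivity)
    _ = _ := by ring

/-- The numerator of the mean squared error, in terms of the excess `p - s / d` of the in-cap
probability over its uniform value. -/
theorem variance_eq {d s p : ℝ} (hd : 1 < d) :
    p * (1 - p) + (d - 1) * ((s - p) / (d - 1) * (1 - (s - p) / (d - 1))) =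
      d * (s / d) * (1 - s / d) - d / (d - 1) * (p - s / d) ^ 2 := by
  have : d - 1 ≠ 0 := by linarith
  have : d ≠ 0 := by linarith
  field_simp
  ring

theorem scaling_eq {d s p : ℝ} (hd : 1 < d) :
    p - (s - p) / (d - 1) = d / (d - 1) * (p - s / d) := by
  have : d - 1 ≠ 0 := by linarith
  have : d ≠ 0 := by linarith
  field_simp
  ring

theorem sq_excess_le {d μ E : ℝ} (hd : 1 < d) (hμd : 1 ≤ d * μ) (hμ0 : 0 < μ) (hμ1 : μ < 1)
    (hE : 1 < E) (hy : 1 ≤ (E + 1) * μ) :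
    d / (d - 1) * (μ * (1 - μ) * (E - 1) / (E * μ + (1 - μ))) ^ 2 ≤
      d * μ * (1 - μ) * (1 - 1 / (2 * ((E + 1) * μ))) := by
  set a := E * μ + (1 - μ) with ha
  have hE' : 0 < E - 1 := by linarith
  have hμ' : 0 < 1 - μ := by linarith
  have hd' : 0 < d - 1 := by linarith
  have ha1 : 1 ≤ a := by nlinarith
  have ha0 : 0 < a := by linarith
  set x := μ * (E - 1) / a with hx
  have hx0 : 0 < x := by positivity
  have hxa : x = 1 - 1 / a := by
    rw [hx]
    field_simp
    rw [ha]
    ring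
  have hx1 : x ≤ 1 := by
    rw [hxa]
    have : 0 < 1 / a := by positivity
    linarith
  have hxy : x ≤ 1 - 1 / (2 * ((E + 1) * μ)) := by
    rw [hxa]
    have : 1 / (2 * ((E + 1) * μ)) ≤ 1 / a := by
      apply one_div_le_one_div_of_le ha0
      nlinarith
    linarith
  have h1 : d * (1 - μ) / (d - 1) ≤ 1 := by
    rw [div_le_one hd']
    linarith
  calc d / (d - 1) * (μ * (1 - μ) * (E - 1) / a) ^ 2
      = d * (1 - μ) / (d - 1) * ((1 - μ) * x ^ 2) := by rw [hx]; field_simp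
    _ ≤ 1 * ((1 - μ) * x ^ 2) := by gcongr
    _ ≤ 1 * ((1 - μ) * x) := by
      gcongr
      nlinarith
    _ ≤ (d * μ) * ((1 - μ) * x) := by gcongr
    _ = d * μ * (1 - μ) * x := by ring
    _ ≤ _ := by gcongr

theorem variance_le_sq {N E μ lam : ℝ} (hN0 : 0 < N) (hE : 0 < E) (hμ0 : 0 < μ) (hμ1 : μ ≤ 0.8)
    (hlam : 0 < lam)
    (hN : N ≥ 2 * (E + 1) ^ 2 * (1 + lam) ^ 2 / ((0.24 : ℝ) ^ 2 * lam ^ 2) *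
      Real.log (8 * (1 + lam) / ((0.24 : ℝ) * lam))) :
    μ * (1 - μ) / N ≤
      (2 * (lam / (5 * (1 + lam) * ((E + 1) * μ))) * (μ * (1 - μ))) ^ 2 := by
  have hL : 1 ≤ Real.log (8 * (1 + lam) / ((0.24 : ℝ) * lam)) := by
    rw [Real.le_log_iff_exp_le (by positivity), le_div_iff₀ (by positivity)]
    nlinarith [Real.exp_one_lt_d9]
  have hN' : 2 * (E + 1) ^ 2 * (1 + lam) ^ 2 / ((0.24 : ℝ) ^ 2 * lam ^ 2) ≤ N :=
    (le_mul_of_one_le_right (by positivity) hL).trans hN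
  have h1 : 0 < 1 - μ := by linarith
  rw [div_le_iff₀ hN0]
  calc μ * (1 - μ) ≤ 8 / (25 * 0.24 ^ 2) * (1 - μ) ^ 2 := by nlinarith
    _ = (2 * (lam / (5 * (1 + lam) * ((E + 1) * μ))) * (μ * (1 - μ))) ^ 2 *
        (2 * (E + 1) ^ 2 * (1 + lam) ^ 2 / ((0.24 : ℝ) ^ 2 * lam ^ 2)) := by
      field_simp
      ring
    _ ≤ _ := by gcongr

theorem subset_size_bounds {d s : ℕ} {ε : ℝ} (hd : 2 ≤ d) (hε : 1 ≤ ε)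
    (hs : s = ⌈(d : ℝ) / (1 + Real.exp ε)⌉₊) :
    0 < s ∧ (s : ℝ) ≤ 0.8 * d ∧ (d : ℝ) ≤ s * (Real.exp ε + 1) := by
  have hd' : (2 : ℝ) ≤ d := by exact_mod_cast hd
  have hE : 2.7 ≤ Real.exp ε := by
    have := Real.exp_le_exp.2 hε
    linarith [Real.exp_one_gt_d9]
  have hpos : 0 < (d : ℝ) / (1 + Real.exp ε) := by positivity
  refine ⟨hs ▸ Nat.ceil_pos.2 hpos, ?_, ?_⟩
  · have h1 := Nat.ceil_lt_add_one hpos.le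
    rw [← hs] at h1
    have h2 : (d : ℝ) / (1 + Real.exp ε) ≤ d / 3.7 := by
      gcongr
      linarith
    have h3 : (d : ℝ) / 3.7 ≤ 0.3 * d := by
      rw [div_le_iff₀ (by norm_num)]
      linarith
    linarith
  · have h1 := Nat.le_ceil ((d : ℝ) / (1 + Real.exp ε))
    rw [← hs, div_le_iff₀ (by positivity)] at h1
    linarith

theorem setOf_exists_eq_const {α : Type*} [Nonempty α] {f : α → ℝ} {c : ℝ} (h : ∀ x, f x = c) :
    {r : ℝ | ∃ x, r = f x} = {c} := by
  ext r
  simp [h]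

/-- **Corollary (frequency estimation, Section 5).**  For `d ≥ 2`, `1 ≤ ε ≤ d−1`,
`s = ⌈d/(1+e^ε)⌉`, `λ > 0` and `N ≥ 2(e^ε+1)²(1+λ)²/(0.24²λ²)·ln(8(1+λ)/(0.24λ))`,
the worst-case (over one-hot input tuples) frequency-estimation squared error of MMRC
simulating Subset Selection is at most `(1+4λ+5λ²+2λ³)` times that of Subset Selection. -/
theorem mmrc_frequency_estimation
    (d : ℕ) (hd : 2 ≤ d) (ε : ℝ) (hε1 : 1 ≤ ε) (hεd : ε ≤ (d : ℝ) - 1)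
    (s : ℕ) (hs : s = ⌈(d : ℝ) / (1 + Real.exp ε)⌉₊)
    (lam : ℝ) (hlam : 0 < lam)
    (N : ℕ) (hN0 : 0 < N)
    (hN : (N : ℝ) ≥ 2 * (Real.exp ε + 1) ^ 2 * (1 + lam) ^ 2 / ((0.24 : ℝ) ^ 2 * lam ^ 2) *
        Real.log (8 * (1 + lam) / ((0.24 : ℝ) * lam)))
    (n : ℕ) (hn : 0 < n) :
    sSup {r : ℝ | ∃ xs : Fin n → Fin d, r = errMmrcMech d s N n ε xs}
      ≤ (1 + 4 * lam + 5 * lam ^ 2 + 2 * lam ^ 3) *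
        sSup {r : ℝ | ∃ xs : Fin n → Fin d, r = errSSMech d s n ε xs} := by
  obtain ⟨hs0, hs8, hsE⟩ := subset_size_bounds hd hε1 hs
  have hd2 : (2 : ℝ) ≤ d := by exact_mod_cast hd
  have hd1 : (1 : ℝ) < d := by linarith
  have hd0 : (0 : ℝ) < d := by linarith
  have hsd : s < d := by
    have : (s : ℝ) < d := by linarith
    exact_mod_cast this
  have hn0 : (0 : ℝ) < n := by exact_mod_cast hn
  have hs1 : (1 : ℝ) ≤ s := by exact_mod_cast hs0
  have hE : 1 < Real.exp ε := Real.one_lt_exp_iff.2 (by linarith)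
  have hN0' : (0 : ℝ) < N := by exact_mod_cast hN0
  have hμ0 : (0 : ℝ) < s / d := by positivity
  have hμ8 : (s : ℝ) / d ≤ 0.8 := (div_le_iff₀ hd0).2 hs8
  have hμd : (d : ℝ) * (s / d) = s := by field_simp
  have hy : 1 ≤ (Real.exp ε + 1) * (s / d) := by
    rw [← mul_div_assoc, le_div_iff₀ hd0]
    linarith
  set p := egMmrc d s N ε with hp
  set p₀ := Real.exp ε * (s / d) / (Real.exp ε * (s / d) + (1 - s / d)) with hp₀
  have ha : 0 < Real.exp ε * (s / d) + (1 - s / d) := by nlinarith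
  have ha' : 0 < (s : ℝ) * Real.exp ε + (d - s) := by nlinarith
  have ha'' : (s : ℝ) * (Real.exp ε - 1) + d ≠ 0 := by
    have : (s : ℝ) * (Real.exp ε - 1) + d = s * Real.exp ε + (d - s) := by ring
    rw [this]
    exact ha'.ne'
  have hd1' : (d : ℝ) - 1 ≠ 0 := by linarith
  have hp₀' : s * Real.exp ε / (s * Real.exp ε + (d - s)) = p₀ := by
    rw [hp₀, div_eq_div_iff ha'.ne' ha.ne']
    field_simp
  have hδ₀ : p₀ - s / d = (s / d) * (1 - s / d) * (Real.exp ε - 1) /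
      (Real.exp ε * (s / d) + (1 - s / d)) := by
    rw [hp₀, eq_div_iff ha.ne', sub_mul, div_mul_cancel₀ _ ha.ne']
    ring
  have hμ' : 0 < 1 - (s : ℝ) / d := by linarith
  have hE' : 0 < Real.exp ε - 1 := by linarith
  have hδ₀0 : 0 < p₀ - s / d := by
    rw [hδ₀]
    positivity
  have hple : p ≤ p₀ := egMmrc_le (by linarith) hsd hN0
  set κ := lam / (5 * (1 + lam) * ((Real.exp ε + 1) * (s / d))) with hκ
  have hκ0 : 0 < κ := by positivity
  have hpge : (p₀ - s / d) * (1 - κ) ≤ p - s / d := by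
    have h := le_egMmrc (ε := ε) (v := 2 * κ * (s / d * (1 - s / d))) (by linarith) hsd hN0
      (by positivity) (variance_le_sq hN0' (by linarith) hμ0 hμ8 hlam hN)
    have h2 : (Real.exp ε - 1) / (Real.exp ε * (s / d) + (1 - s / d)) *
        (2 * κ * (s / d * (1 - s / d)) / 2) = (p₀ - s / d) * κ := by
      rw [hδ₀]
      ring
    rw [h2] at h
    linarith
  have hδ0 : 0 < p - s / d := by
    refine lt_of_lt_of_le (mul_pos hδ₀0 ?_) hpge
    have : κ < 1 := by
      rw [hκ, div_lt_one (by positivity)]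
      nlinarith
    linarith
  have hD : 0 < (d : ℝ) / (d - 1) := div_pos hd0 (by linarith)
  have hbss : bss d s ε = (s - p₀) / (d - 1) := by
    rw [← hp₀', bss]
    field_simp
    ring
  have hmss : mss d s ε = p₀ - bss d s ε := by
    rw [← hp₀', bss, mss]
    field_simp
    ring
  have hbm : bMmrcSS d s N ε = (s - p) / (d - 1) := by
    rw [bMmrcSS]
    ring
  have hmm : mMmrcSS d s N ε = p - bMmrcSS d s N ε := by
    rw [mMmrcSS, hbm]
    field_simp
    ring
  have hmss' : mss d s ε = d / (d - 1) * (p₀ - s / d) := by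
    rw [hmss, hbss, scaling_eq hd1]
  have hmm' : mMmrcSS d s N ε = d / (d - 1) * (p - s / d) := by
    rw [hmm, hbm, scaling_eq hd1]
  have hSS : ∀ xs, errSSMech d s n ε xs =
      (d * (s / d) * (1 - s / d) - d / (d - 1) * (p₀ - s / d) ^ 2) /
        (d / (d - 1) * (p₀ - s / d)) ^ 2 / n := fun xs =>
    (mean_sq_error_eq hd hn (q := qss d s ε) (fun j σ hσ A => qss_map s ε hσ A)
      (sum_qss ε hs0 hsd) (fun j => (sum_qss_mem ε hs0 hsd j).trans hp₀') hbss hmss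
      (by rw [hmss']; positivity) xs).trans (by rw [hmss', hbss, variance_eq hd1])
  have hMM : ∀ xs, errMmrcMech d s N n ε xs =
      (d * (s / d) * (1 - s / d) - d / (d - 1) * (p - s / d) ^ 2) /
        (d / (d - 1) * (p - s / d)) ^ 2 / n := fun xs =>
    (mean_sq_error_eq hd hn (q := qMmrcOut d s N ε)
      (fun j σ hσ A => qMmrcOut_map s N ε hσ A) (sum_qMmrcOut ε hsd hN0)
      (sum_qMmrcOut_mem ε hs0 hsd hN0) hbm hmm (by rw [hmm']; positivity) xs).trans
      (by rw [hmm', hbm, variance_eq hd1])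
  have : Nonempty (Fin n → Fin d) := ⟨fun _ => ⟨0, by omega⟩⟩
  rw [setOf_exists_eq_const hMM, setOf_exists_eq_const hSS, csSup_singleton, csSup_singleton,
    ← mul_div_assoc (1 + 4 * lam + 5 * lam ^ 2 + 2 * lam ^ 3)]
  refine div_le_div_of_nonneg_right ?_ hn0.le
  refine error_ratio_le (by positivity) hD hδ₀0 hlam hy ?_ (by linarith) hpge
  rw [hδ₀]
  exact sq_excess_le hd1 (by rw [hμd]; exact hs1) hμ0 (by linarith) hE hy
end
end

section
/- Let ε ≥ 0, c1 ≥ c2 > 0 with c1 ≤ e^ε·c2, N ≥ 1 an integer, μ ∈ [0,1], and θ ∈ [0,1] with N·θ an integer. Let π^mrc_θ be the distribution on {1,…,N} putting mass c1/(N(θ·c1+(1−θ)·c2)) on each of the N·θ in-cap indices and c2/(N(θ·c1+(1−θ)·c2)) on each of the N(1−θ) out-cap indices, and let π^mmrc_θ be its MMRC modification. Then the Kullback–Leibler divergence (in nats) satisfies KL(π^mrc_θ ‖ π^mmrc_θ) = Σ_{k=1}^N π^mrc_θ(k)·ln(π^mrc_θ(k)/π^mmrc_θ(k)) ≤ ε.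 -/
open scoped Classical
open Real Finset

noncomputable section

/-- The MRC index distribution for a cap-based mechanism with in-cap values `c1`,
out-cap values `c2`, in-cap index set `S` and in-cap fraction `θ`. -/
def piMrcGen (c1 c2 θ : ℝ) {N : ℕ} (S : Finset (Fin N)) (k : Fin N) : ℝ :=
  (if k ∈ S then c1 else c2) / ((N : ℝ) * (θ * c1 + (1 - θ) * c2))

/-- The MMRC modification of `piMrcGen`, with cap proportion `μ`,
`a = μ·c1 + (1−μ)·c2`, `t_u = c1/(N·a)`, `t_l = c2/(N·a)`. -/
def piMmrcGen (c1 c2 μ θ : ℝ) {N : ℕ} (S : Finset (Fin N)) (k : Fin N) : ℝ :=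
  let a : ℝ := μ * c1 + (1 - μ) * c2
  let tu : ℝ := c1 / ((N : ℝ) * a)
  let tl : ℝ := c2 / ((N : ℝ) * a)
  if θ < μ then
    (if k ∈ S then tu else (1 - (N : ℝ) * θ * tu) / ((N : ℝ) * (1 - θ)))
  else if μ < θ then
    (if k ∈ S then (1 - (N : ℝ) * (1 - θ) * tl) / ((N : ℝ) * θ) else tl)
  else piMrcGen c1 c2 θ S k

/-- The KL divergence (in nats) between the MRC and MMRC index distributions. -/
def klMrcMmrc (c1 c2 μ θ : ℝ) {N : ℕ} (S : Finset (Fin N)) : ℝ :=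
  ∑ k : Fin N,
    piMrcGen c1 c2 θ S k * Real.log (piMrcGen c1 c2 θ S k / piMmrcGen c1 c2 μ θ S k)

/-- A proportion `θ ∈ [0, 1]` mixes `c2 ≤ c1` to a value in `[c2, c1]`. -/
lemma mix_mem_Icc {c1 c2 θ : ℝ} (hc12 : c2 ≤ c1) (hθ0 : 0 ≤ θ) (hθ1 : θ ≤ 1) :
    θ * c1 + (1 - θ) * c2 ∈ Set.Icc c2 c1 := by
  constructor <;> nlinarith

lemma piMrcGen_pos {c1 c2 θ : ℝ} (hc2 : 0 < c2) (hc12 : c2 ≤ c1) {N : ℕ} (hN : 1 ≤ N)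
    (hθ0 : 0 ≤ θ) (hθ1 : θ ≤ 1) (S : Finset (Fin N)) (k : Fin N) :
    0 < piMrcGen c1 c2 θ S k := by
  have hN' : (0 : ℝ) < N := by exact_mod_cast hN
  have hc1 : 0 < c1 := hc2.trans_le hc12
  have hm : 0 < θ * c1 + (1 - θ) * c2 := hc2.trans_le (mix_mem_Icc hc12 hθ0 hθ1).1
  unfold piMrcGen
  split_ifs <;> positivity

lemma sum_piMrcGen {c1 c2 θ : ℝ} (hc2 : 0 < c2) (hc12 : c2 ≤ c1) {N : ℕ} (hN : 1 ≤ N)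
    (hθ0 : 0 ≤ θ) (hθ1 : θ ≤ 1) (S : Finset (Fin N)) (hS : (S.card : ℝ) = (N : ℝ) * θ) :
    ∑ k, piMrcGen c1 c2 θ S k = 1 := by
  have hN' : (0 : ℝ) < N := by exact_mod_cast hN
  have hm : 0 < θ * c1 + (1 - θ) * c2 := hc2.trans_le (mix_mem_Icc hc12 hθ0 hθ1).1
  have hcompl : ((Sᶜ).card : ℝ) = N * (1 - θ) := by
    have h : (S.card : ℝ) + (Sᶜ).card = N := by
      exact_mod_cast (Finset.card_add_card_compl S).trans (Fintype.card_fin N)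
    linarith
  have hsum : ∑ k, (if k ∈ S then c1 else c2) = N * (θ * c1 + (1 - θ) * c2) := by
    rw [← Finset.sum_add_sum_compl S,
      Finset.sum_congr rfl fun k hk => if_pos hk,
      Finset.sum_congr rfl fun k hk => if_neg (Finset.mem_compl.mp hk),
      Finset.sum_const, Finset.sum_const, nsmul_eq_mul, nsmul_eq_mul, hS, hcompl]
    ring
  simp only [piMrcGen]
  rw [← Finset.sum_div, hsum, div_self (by positivity)]

/-- The MRC masses exceed the MMRC masses by a factor of at most `exp ε`. -/
lemma piMrcGen_le_exp_mul_piMmrcGen {ε c1 c2 μ θ : ℝ} (hε : 0 ≤ ε) (hc2 : 0 < c2)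
    (hc12 : c2 ≤ c1) (hc1e : c1 ≤ Real.exp ε * c2) {N : ℕ} (hN : 1 ≤ N)
    (hμ0 : 0 ≤ μ) (hμ1 : μ ≤ 1) (hθ0 : 0 ≤ θ) (hθ1 : θ ≤ 1)
    (S : Finset (Fin N)) (k : Fin N) :
    piMrcGen c1 c2 θ S k ≤ Real.exp ε * piMmrcGen c1 c2 μ θ S k := by
  have hN' : (0 : ℝ) < N := by exact_mod_cast hN
  have hc1 : 0 < c1 := hc2.trans_le hc12
  have hE : 1 ≤ Real.exp ε := Real.one_le_exp hε
  have hpos := piMrcGen_pos hc2 hc12 hN hθ0 hθ1 S k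
  obtain ⟨hm, -⟩ := mix_mem_Icc hc12 hθ0 hθ1
  obtain ⟨ha, ha'⟩ := mix_mem_Icc hc12 hμ0 hμ1
  have hmono : 0 ≤ (μ - θ) * (c1 - c2) ↔
      θ * c1 + (1 - θ) * c2 ≤ μ * c1 + (1 - μ) * c2 := by
    constructor <;> intro h <;> linarith
  have hmE : c1 ≤ Real.exp ε * (θ * c1 + (1 - θ) * c2) := hc1e.trans (by gcongr)
  have hm0 := hc2.trans_le hm
  have ha0 := hc2.trans_le ha
  unfold piMmrcGen
  dsimp only
  generalize hadef : μ * c1 + (1 - μ) * c2 = a at *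
  split_ifs with hlt hk hgt hk
  · simp only [piMrcGen, if_pos hk]
    generalize θ * c1 + (1 - θ) * c2 = m at *
    rw [← mul_div_assoc, div_le_div_iff₀ (by positivity) (by positivity)]
    have : a ≤ Real.exp ε * m := ha'.trans hmE
    calc c1 * (N * a) ≤ c1 * (N * (Real.exp ε * m)) := by gcongr
      _ = Real.exp ε * c1 * (N * m) := by ring
  · have hθ : 0 < 1 - θ := by linarith
    have hma := hmono.1 (mul_nonneg (by linarith) (by linarith))
    have hle : piMrcGen c1 c2 θ S k ≤ (1 - N * θ * (c1 / (N * a))) / (N * (1 - θ)) := by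
      have heq : piMrcGen c1 c2 θ S k =
          (1 - N * θ * (c1 / (N * (θ * c1 + (1 - θ) * c2)))) / (N * (1 - θ)) := by
        simp only [piMrcGen, if_neg hk]
        field_simp
        ring
      rw [heq]
      gcongr
    exact hle.trans (le_mul_of_one_le_left (hpos.le.trans hle) hE)
  · have hθ : 0 < θ := by linarith
    have htl : c2 / (N * a) ≤ 1 / N := by
      rw [div_le_div_iff₀ (by positivity) hN']
      nlinarith
    have hle : 1 / (N : ℝ) ≤ (1 - N * (1 - θ) * (c2 / (N * a))) / (N * θ) := by
      have heq : 1 / (N : ℝ) = (1 - N * (1 - θ) * (1 / N)) / (N * θ) := by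
        field_simp
        ring
      have : 0 ≤ 1 - θ := by linarith
      rw [heq]
      gcongr
    refine le_trans ?_ (mul_le_mul_of_nonneg_left hle (Real.exp_pos ε).le)
    simp only [piMrcGen, if_pos hk]
    generalize θ * c1 + (1 - θ) * c2 = m at *
    rw [mul_one_div, div_le_div_iff₀ (by positivity) hN']
    nlinarith
  · have ham : a ≤ θ * c1 + (1 - θ) * c2 := by
      rw [← hadef]
      nlinarith
    have hle : piMrcGen c1 c2 θ S k ≤ c2 / (N * a) := by
      simp only [piMrcGen, if_neg hk]
      gcongr
    exact hle.trans (le_mul_of_one_le_left (hpos.le.trans hle) hE)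
  · exact le_mul_of_one_le_left hpos.le hE

/-- **Lemma B.1.**  For any in-cap fraction `θ` (with `N·θ` an integer), the KL divergence
between the MRC and MMRC index distributions is at most `ε`. -/
theorem kl_mrc_mmrc_le
    (ε c1 c2 μ θ : ℝ) (hε : 0 ≤ ε) (hc2 : 0 < c2) (hc12 : c2 ≤ c1)
    (hc1e : c1 ≤ Real.exp ε * c2)
    (N : ℕ) (hN : 1 ≤ N)
    (hμ0 : 0 ≤ μ) (hμ1 : μ ≤ 1) (hθ0 : 0 ≤ θ) (hθ1 : θ ≤ 1)
    (S : Finset (Fin N)) (hS : (S.card : ℝ) = (N : ℝ) * θ) :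
    klMrcMmrc c1 c2 μ θ S ≤ ε := by
  have hlog : ∀ k, Real.log (piMrcGen c1 c2 θ S k / piMmrcGen c1 c2 μ θ S k) ≤ ε := fun k => by
    have hpos := piMrcGen_pos hc2 hc12 hN hθ0 hθ1 S k
    have hle := piMrcGen_le_exp_mul_piMmrcGen hε hc2 hc12 hc1e hN hμ0 hμ1 hθ0 hθ1 S k
    have hpos' : 0 < piMmrcGen c1 c2 μ θ S k :=
      pos_of_mul_pos_right (hpos.trans_le hle) (Real.exp_pos ε).le
    rw [Real.log_le_iff_le_exp (div_pos hpos hpos'), div_le_iff₀ hpos']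
    exact hle
  calc klMrcMmrc c1 c2 μ θ S ≤ ∑ k, piMrcGen c1 c2 θ S k * ε :=
        Finset.sum_le_sum fun k _ => mul_le_mul_of_nonneg_left (hlog k)
          (piMrcGen_pos hc2 hc12 hN hθ0 hθ1 S k).le
    _ = ε := by rw [← Finset.sum_mul, sum_piMrcGen hc2 hc12 hN hθ0 hθ1 S hS, one_mul]
end
end

section
/- Let (p_1,…,p_d) be a probability vector and let X be a random one-hot vector in {0,1}^d with P(X = e_i) = p_i; run MRC simulating Subset Selection on X with N candidates. Then for each coordinate i: P((Z_K)_i = 1) = p_i·m_mrc + b_mrc. Moreover, for a deterministic one-hot input x, E[Z_K] = m_mrc·x + b_mrc·𝟙; hence when m_mrc ≠ 0 the estimator x̂^mrc := (Z_K − b_mrc·𝟙)/m_mrc is unbiased: E[x̂^mrc] = x. -/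
open scoped Classical
open Real Finset

noncomputable section

/-- Grouping tuples over `S` by the number of entries satisfying `P`. -/
lemma sum_piFinset_apply_card_filter {α : Type*} [DecidableEq α] (N : ℕ) (S : Finset α)
    (P : α → Prop) [DecidablePred P] (f : ℕ → ℝ) :
    ∑ zs ∈ Fintype.piFinset (fun _ : Fin N => S), f (#{k | P (zs k)}) =
      ∑ M ∈ range (N + 1),
        (N.choose M : ℝ) * (#{x ∈ S | P x} : ℝ) ^ M * (#{x ∈ S | ¬ P x} : ℝ) ^ (N - M) * f M := by
  have hfiber (T : Finset (Fin N)) :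
      ({zs ∈ Fintype.piFinset (fun _ : Fin N => S) | ({k | P (zs k)} : Finset (Fin N)) = T}) =
        Fintype.piFinset fun k => if k ∈ T then {x ∈ S | P x} else {x ∈ S | ¬ P x} := by
    ext zs
    simp only [mem_filter, Fintype.mem_piFinset, Finset.ext_iff, mem_univ, true_and]
    constructor
    · rintro ⟨h, hT⟩ k
      by_cases hk : k ∈ T
      · simp [hk, h k, (hT k).2 hk]
      · simp [hk, h k, mt (hT k).1 hk]
    · intro h
      refine ⟨fun k => ?_, fun k => ?_⟩ <;> have := h k <;> by_cases hk : k ∈ T <;>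
        simp_all
  rw [← sum_fiberwise_of_maps_to (t := (univ : Finset (Fin N)).powerset)
    (g := fun zs => ({k | P (zs k)} : Finset (Fin N))) (by simp)]
  have hsum : ∀ T ∈ (univ : Finset (Fin N)).powerset,
      ∑ zs ∈ Fintype.piFinset (fun _ : Fin N => S) with
          ({k | P (zs k)} : Finset (Fin N)) = T, f (#{k | P (zs k)}) =
        (fun M => (#{x ∈ S | P x} : ℝ) ^ M * (#{x ∈ S | ¬ P x} : ℝ) ^ (N - M) * f M) #T := by
    intro T _
    rw [sum_congr rfl (g := fun _ => f #T) fun zs hzs => by rw [(mem_filter.1 hzs).2], hfiber,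
      sum_const, Fintype.card_piFinset, nsmul_eq_mul]
    simp only [apply_ite Finset.card, prod_ite, prod_const, filter_mem_eq_inter, univ_inter,
      ← compl_eq_univ_sdiff, filter_not, card_compl, Fintype.card_fin]
    push_cast
    rfl
  rw [sum_congr rfl hsum, sum_powerset_apply_card
    fun M => (#{x ∈ S | P x} : ℝ) ^ M * (#{x ∈ S | ¬ P x} : ℝ) ^ (N - M) * f M]
  simp [nsmul_eq_mul, mul_assoc]

/-- Expectations over tuples of i.i.d. uniform draws from `S` of functions of the fraction of
entries satisfying `P` are binomial expectations. -/
lemma sum_piFinset_eq_binomExp {α : Type*} [DecidableEq α] (N : ℕ) (S : Finset α)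
    (hS : S.Nonempty) (P : α → Prop) [DecidablePred P] (f : ℝ → ℝ) :
    ∑ zs ∈ Fintype.piFinset (fun _ : Fin N => S),
        (1 / (#S : ℝ)) ^ N * f ((#{k | P (zs k)} : ℝ) / N) =
      binomExp N ((#{x ∈ S | P x} : ℝ) / #S) f := by
  have hS0 : (#S : ℝ) ≠ 0 := by exact_mod_cast hS.card_pos.ne'
  have hcompl : 1 - (#{x ∈ S | P x} : ℝ) / #S = (#{x ∈ S | ¬ P x} : ℝ) / #S := by
    have h : (#{x ∈ S | P x} : ℝ) + #{x ∈ S | ¬ P x} = #S := by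
      exact_mod_cast card_filter_add_card_filter_not (s := S) P
    field_simp
    linarith
  rw [← mul_sum, sum_piFinset_apply_card_filter N S P fun M => f ((M : ℝ) / N), binomExp, hcompl,
    mul_sum]
  refine sum_congr rfl fun M hM => ?_
  have hM : M ≤ N := by simpa [Nat.lt_succ_iff] using hM
  have hpow : (#S : ℝ) ^ N = (#S : ℝ) ^ M * (#S : ℝ) ^ (N - M) := by
    rw [← pow_add, Nat.add_sub_cancel' hM]
  rw [one_div, inv_pow, div_pow, div_pow, hpow]
  field_simp

lemma binomExp_const_sub (N : ℕ) (μ c : ℝ) (f : ℝ → ℝ) :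
    binomExp N μ (fun θ => c - f θ) = c - binomExp N μ f := by
  have h : ∑ M ∈ range (N + 1), (N.choose M : ℝ) * μ ^ M * (1 - μ) ^ (N - M) = 1 := by
    have := add_pow μ (1 - μ) N
    rw [add_sub_cancel, one_pow] at this
    exact (sum_congr rfl fun M _ => by ring).trans this.symm
  simp only [binomExp, mul_sub, sum_sub_distrib, ← sum_mul, h, one_mul]

lemma card_of_mem_zset {d s : ℕ} {A : Finset (Fin d)} (hA : A ∈ zset d s) : #A = s :=
  (mem_powersetCard.1 hA).2

lemma map_perm_mem_zset {d s : ℕ} (σ : Equiv.Perm (Fin d)) {A : Finset (Fin d)}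
    (hA : A ∈ zset d s) : A.map σ.toEmbedding ∈ zset d s := by
  simpa [zset, mem_powersetCard] using card_of_mem_zset hA

lemma map_perm_map_symm {d : ℕ} (σ : Equiv.Perm (Fin d)) (A : Finset (Fin d)) :
    (A.map σ.toEmbedding).map σ.symm.toEmbedding = A := by
  ext x
  simp

lemma map_symm_map_perm {d : ℕ} (σ : Equiv.Perm (Fin d)) (A : Finset (Fin d)) :
    (A.map σ.symm.toEmbedding).map σ.toEmbedding = A := by
  ext x
  simp

/-- Every coordinate lies in the same number of sets of `zset d s`. -/
lemma card_zset_filter_mem (d s : ℕ) (j : Fin d) :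
    (d : ℝ) * #{A ∈ zset d s | j ∈ A} = s * #(zset d s) := by
  have hsymm (i : Fin d) : #{A ∈ zset d s | i ∈ A} = #{A ∈ zset d s | j ∈ A} := by
    refine card_nbij' (fun A => A.map (Equiv.swap i j).toEmbedding)
      (fun A => A.map (Equiv.swap i j).symm.toEmbedding) ?_ ?_
      (fun A _ => map_perm_map_symm _ A) (fun A _ => map_symm_map_perm _ A)
    · intro A hA
      have hA := mem_filter.1 hA
      exact mem_filter.2 ⟨map_perm_mem_zset _ hA.1, mem_map.2 ⟨i, hA.2, by simp⟩⟩
    · intro A hA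
      have hA := mem_filter.1 hA
      exact mem_filter.2 ⟨map_perm_mem_zset _ hA.1, mem_map.2 ⟨j, hA.2, by simp⟩⟩
  have hcount : ∑ i : Fin d, #{A ∈ zset d s | i ∈ A} = s * #(zset d s) := by
    simp only [card_filter]
    rw [sum_comm, sum_congr rfl (g := fun _ => s) fun A hA => ?_, sum_const, smul_eq_mul, mul_comm]
    simpa using card_of_mem_zset hA
  rw [sum_congr rfl fun i _ => hsymm i] at hcount
  simp only [sum_const, card_univ, Fintype.card_fin, smul_eq_mul] at hcount
  exact_mod_cast hcount

/-- Expectations under `qMrcOut` as expectations over the candidates and the selected index. -/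
lemma sum_qMrcOut_mul (d s N : ℕ) (ε : ℝ) (j : Fin d) (f : Finset (Fin d) → ℝ) :
    ∑ A ∈ zset d s, qMrcOut d s N ε j A * f A =
      ∑ zs ∈ Fintype.piFinset (fun _ : Fin N => zset d s),
        (1 / (#(zset d s) : ℝ)) ^ N * ∑ k : Fin N, piMrcSS d N ε j zs k * f (zs k) := by
  simp only [qMrcOut, sum_mul]
  rw [sum_comm]
  refine sum_congr rfl fun zs hzs => ?_
  simp only [mul_assoc, ← mul_sum, sum_mul]
  rw [sum_comm]
  congr 1
  refine sum_congr rfl fun k _ => ?_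
  simp [ite_mul, Fintype.mem_piFinset.1 hzs k]

lemma sum_weights_pos (d N : ℕ) (hN : 0 < N) (ε : ℝ) (j : Fin d)
    (zs : Fin N → Finset (Fin d)) :
    0 < ∑ k : Fin N, (if j ∈ zs k then Real.exp ε else 1) := by
  have : Nonempty (Fin N) := ⟨⟨0, hN⟩⟩
  exact sum_pos (fun k _ => by split_ifs <;> positivity) univ_nonempty

lemma sum_piMrcSS (d N : ℕ) (hN : 0 < N) (ε : ℝ) (j : Fin d) (zs : Fin N → Finset (Fin d)) :
    ∑ k : Fin N, piMrcSS d N ε j zs k = 1 := by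
  simp only [piMrcSS, ← sum_div]
  exact div_self (sum_weights_pos d N hN ε j zs).ne'

/-- The probability of selecting an in-cap candidate is a function of the in-cap fraction. -/
lemma sum_piMrcSS_mul_mem (d N : ℕ) (hN : 0 < N) (ε : ℝ) (j : Fin d)
    (zs : Fin N → Finset (Fin d)) :
    ∑ k : Fin N, piMrcSS d N ε j zs k * (if j ∈ zs k then (1 : ℝ) else 0) =
      hMrc ε ((#{k | j ∈ zs k} : ℝ) / N) := by
  have hN' : (N : ℝ) ≠ 0 := by exact_mod_cast hN.ne'
  have hcompl : (#{k | j ∈ zs k} : ℝ) + #{k | ¬ j ∈ zs k} = N := by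
    have := card_filter_add_card_filter_not (s := (univ : Finset (Fin N))) fun k => j ∈ zs k
    rw [card_univ, Fintype.card_fin] at this
    exact_mod_cast this
  have hden : ∑ k : Fin N, (if j ∈ zs k then Real.exp ε else 1) =
      #{k | j ∈ zs k} * Real.exp ε + (N - #{k | j ∈ zs k}) := by
    rw [sum_ite, sum_const, sum_const, nsmul_eq_mul, nsmul_eq_mul, mul_one, ← hcompl]
    ring
  have hnum : ∑ k : Fin N, (if j ∈ zs k then Real.exp ε else 1) *
      (if j ∈ zs k then (1 : ℝ) else 0) = #{k | j ∈ zs k} * Real.exp ε := by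
    rw [sum_congr rfl (g := fun k => if j ∈ zs k then Real.exp ε else 0)
      fun k _ => by split_ifs <;> simp, ← sum_filter, sum_const, nsmul_eq_mul]
  simp only [piMrcSS, div_mul_eq_mul_div, ← sum_div, hnum, hden, hMrc]
  rw [← mul_div_mul_right (Real.exp ε * _) _ hN']
  congr 1 <;> field_simp

/-- The coordinate marginals off the input coordinate all agree. -/
lemma sum_qMrcOut_mem_eq (d s N : ℕ) (ε : ℝ) {j i i' : Fin d} (hi : i ≠ j) (hi' : i' ≠ j) :
    ∑ A ∈ zset d s, qMrcOut d s N ε j A * (if i ∈ A then (1 : ℝ) else 0) =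
      ∑ A ∈ zset d s, qMrcOut d s N ε j A * (if i' ∈ A then (1 : ℝ) else 0) := by
  simp only [sum_qMrcOut_mul]
  have hmem (A : Finset (Fin d)) : i' ∈ A.map (Equiv.swap i i').toEmbedding ↔ i ∈ A := by
    simp [mem_map_equiv]
  have hmem' (A : Finset (Fin d)) : j ∈ A.map (Equiv.swap i i').toEmbedding ↔ j ∈ A := by
    simp [mem_map_equiv, Equiv.swap_apply_of_ne_of_ne hi.symm hi'.symm]
  refine sum_nbij' (fun zs k => (zs k).map (Equiv.swap i i').toEmbedding)
    (fun zs k => (zs k).map (Equiv.swap i i').symm.toEmbedding) ?_ ?_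
    (fun zs _ => funext fun k => map_perm_map_symm _ (zs k))
    (fun zs _ => funext fun k => map_symm_map_perm _ (zs k)) ?_
  · intro zs hzs
    exact Fintype.mem_piFinset.2 fun k => map_perm_mem_zset _ (Fintype.mem_piFinset.1 hzs k)
  · intro zs hzs
    exact Fintype.mem_piFinset.2 fun k => map_perm_mem_zset _ (Fintype.mem_piFinset.1 hzs k)
  · intro zs _
    simp only [piMrcSS, hmem, hmem']

lemma sum_uniform_weight (d s N : ℕ) (hS : (zset d s).Nonempty) (c : ℝ) :
    ∑ _zs ∈ Fintype.piFinset (fun _ : Fin N => zset d s),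
      (1 / (#(zset d s) : ℝ)) ^ N * c = c := by
  have hS0 : (#(zset d s) : ℝ) ≠ 0 := by exact_mod_cast hS.card_pos.ne'
  rw [sum_const, Fintype.card_piFinset_const, nsmul_eq_mul]
  push_cast
  rw [← mul_assoc, ← mul_pow, mul_one_div_cancel hS0, one_pow, one_mul]

lemma sum_qMrcOut (d s N : ℕ) (hN : 0 < N) (hS : (zset d s).Nonempty) (ε : ℝ) (j : Fin d) :
    ∑ A ∈ zset d s, qMrcOut d s N ε j A = 1 := by
  rw [← sum_uniform_weight d s N hS 1]
  simpa only [mul_one, sum_piMrcSS d N hN] using sum_qMrcOut_mul d s N ε j fun _ => 1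

lemma sum_qMrcOut_mem_self (d s N : ℕ) (hd : 0 < d) (hN : 0 < N) (hS : (zset d s).Nonempty)
    (ε : ℝ) (j : Fin d) :
    ∑ A ∈ zset d s, qMrcOut d s N ε j A * (if j ∈ A then (1 : ℝ) else 0) =
      binomExp N ((s : ℝ) / d) (hMrc ε) := by
  have hS0 : (#(zset d s) : ℝ) ≠ 0 := by exact_mod_cast hS.card_pos.ne'
  have hd0 : (d : ℝ) ≠ 0 := by exact_mod_cast hd.ne'
  have hμ : (s : ℝ) / d = (#{A ∈ zset d s | j ∈ A} : ℝ) / #(zset d s) := by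
    rw [div_eq_div_iff hd0 hS0, ← card_zset_filter_mem d s j, mul_comm]
  simp only [sum_qMrcOut_mul, sum_piMrcSS_mul_mem d N hN, hμ]
  exact sum_piFinset_eq_binomExp N (zset d s) hS (fun A => j ∈ A) (hMrc ε)

lemma sum_sum_qMrcOut_mem (d s N : ℕ) (hN : 0 < N) (hS : (zset d s).Nonempty)
    (ε : ℝ) (j : Fin d) :
    ∑ i : Fin d, ∑ A ∈ zset d s, qMrcOut d s N ε j A * (if i ∈ A then (1 : ℝ) else 0) = s := by
  have h : ∑ A ∈ zset d s, qMrcOut d s N ε j A * s = s := by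
    rw [← sum_mul, sum_qMrcOut d s N hN hS, one_mul]
  rw [sum_comm, ← h]
  refine sum_congr rfl fun A hA => ?_
  simp [card_of_mem_zset hA, mul_comm]

/-- For the one-hot input `e_j`, the output of MRC has mean `m_mrc • e_j + b_mrc • 𝟙`. -/
lemma sum_qMrcOut_mem (d s N : ℕ) (hd : 2 ≤ d) (hN : 0 < N) (hS : (zset d s).Nonempty)
    (ε : ℝ) (j i : Fin d) :
    ∑ A ∈ zset d s, qMrcOut d s N ε j A * (if i ∈ A then (1 : ℝ) else 0) =
      mMrcSS d s N ε * (if i = j then (1 : ℝ) else 0) + bMrcSS d s N ε := by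
  by_cases hij : i = j
  · subst hij
    rw [sum_qMrcOut_mem_self d s N (by lia) hN hS, mMrcSS]
    simp
  · have hd1 : (d : ℝ) - 1 ≠ 0 := by
      have : (2 : ℝ) ≤ d := by exact_mod_cast hd
      linarith
    have h := sum_sum_qMrcOut_mem d s N hN hS ε j
    rw [← add_sum_erase _ _ (mem_univ j), sum_qMrcOut_mem_self d s N (by lia) hN hS,
      sum_congr rfl fun i' hi' => sum_qMrcOut_mem_eq d s N ε (ne_of_mem_erase hi') hij,
      sum_const, card_erase_of_mem (mem_univ j), card_univ, Fintype.card_fin, nsmul_eq_mul,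
      Nat.cast_sub (by lia), Nat.cast_one] at h
    rw [if_neg hij, mul_zero, zero_add, bMrcSS, binomExp_const_sub, one_div,
      eq_inv_mul_iff_mul_eq₀ hd1]
    linarith

lemma zset_nonempty {d s : ℕ} (h : s ≤ d) : (zset d s).Nonempty :=
  powersetCard_nonempty.2 (by simpa using h)

/-- **Lemma G.1.**  The coordinate marginals of MRC simulating Subset Selection are linear
in the prior: `P((Z_K)_i = 1) = p_i·m_mrc + b_mrc`; for a deterministic one-hot input
`E[Z_K] = m_mrc·x + b_mrc·𝟙`; hence when `m_mrc ≠ 0` the debiased estimator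
`x̂^mrc = (Z_K − b_mrc·𝟙)/m_mrc` is unbiased. -/
theorem mrc_ss_unbiased
    (d : ℕ) (hd : 2 ≤ d) (ε : ℝ) (hε1 : 1 ≤ ε)
    (s : ℕ) (hs : s = ⌈(d : ℝ) / (1 + Real.exp ε)⌉₊)
    (N : ℕ) (hN0 : 0 < N)
    (p : Fin d → ℝ) (hp0 : ∀ i, 0 ≤ p i) (hp1 : ∑ i : Fin d, p i = 1) :
    (∀ i : Fin d,
        (∑ j : Fin d, p j * ∑ A ∈ zset d s, (if i ∈ A then qMrcOut d s N ε j A else 0))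
          = p i * mMrcSS d s N ε + bMrcSS d s N ε)
    ∧ (∀ j i : Fin d,
        (∑ A ∈ zset d s, qMrcOut d s N ε j A * (if i ∈ A then (1 : ℝ) else 0))
          = mMrcSS d s N ε * (if i = j then (1 : ℝ) else 0) + bMrcSS d s N ε)
    ∧ (mMrcSS d s N ε ≠ 0 → ∀ j i : Fin d,
        (∑ A ∈ zset d s, qMrcOut d s N ε j A * xhatMrc d s N ε A i)
          = (if i = j then (1 : ℝ) else 0)) := by
  have hsd : s ≤ d := by
    rw [hs, Nat.ceil_le]
    exact div_le_self (Nat.cast_nonneg d) (by linarith [Real.exp_pos ε])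
  have hS := zset_nonempty hsd
  have hmean := sum_qMrcOut_mem d s N hd hN0 hS ε
  refine ⟨fun i => ?_, hmean, fun hm j i => ?_⟩
  · have h (j : Fin d) : ∑ A ∈ zset d s, (if i ∈ A then qMrcOut d s N ε j A else 0) =
        mMrcSS d s N ε * (if i = j then (1 : ℝ) else 0) + bMrcSS d s N ε := by
      rw [← hmean j i]
      simp only [mul_ite, mul_one, mul_zero]
    simp only [h, mul_add, sum_add_distrib, ← sum_mul, hp1, one_mul]
    simp
  · simp only [xhatMrc, ← mul_div_assoc, mul_sub, ← sum_div, sum_sub_distrib, ← sum_mul,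
      hmean j i, sum_qMrcOut d s N hN0 hS, one_mul, add_sub_cancel_right]
    exact mul_div_cancel_left₀ _ hm
end
end
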